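/- Fix a real number α. For a Δ-tree T of order n ≥ 2, let D_α(T) = Σ_{v ∈ V(T)} (deg v)^α be the general Zagreb index of T (well defined on isomorphism classes, and every vertex of a tree of order ≥ 2 has degree ≥ 1). Then there exists a real constant d_α such that for every ε > 0, the probability (under the uniform measure on 𝒯_n^Δ) that |D_α(T) − d_α·n| ≤ ε·n tends to 1 as n → ∞. -/

import Mathlib

open Filter Topology MeasureTheory

namespace TreePaper

/-- The degree of a vertex `v` in a simple graph on `Fin n`. -/
noncomputable def degr {n : ℕ} (G : SimpleGraph (Fin n)) (v : Fin n) : ℕ :=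
  Nat.card {u : Fin n // G.Adj v u}

/-- A `Δ`-tree of order `n`: a tree on `n` vertices with all degrees at most `Δ`. -/
abbrev DTree (Δ n : ℕ) : Type :=
  {G : SimpleGraph (Fin n) // G.IsTree ∧ ∀ v, degr G v ≤ Δ}

instance treeSetoid (Δ n : ℕ) : Setoid (DTree Δ n) where
  r G H := Nonempty (G.1 ≃g H.1)
  iseqv :=
    ⟨fun G => ⟨SimpleGraph.Iso.refl⟩, fun ⟨e⟩ => ⟨e.symm⟩, fun ⟨e⟩ ⟨f⟩ => ⟨e.trans f⟩⟩

/-- Isomorphism classes of `Δ`-trees of order `n`. -/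
abbrev TClass (Δ n : ℕ) : Type := Quotient (treeSetoid Δ n)

/-- The number of vertices of degree `j` in `G`. -/
noncomputable def vcount {n : ℕ} (j : ℕ) (G : SimpleGraph (Fin n)) : ℕ :=
  Nat.card {v : Fin n // degr G v = j}

/-- The number of vertices of degree `j`, as a random variable on iso classes. -/
noncomputable def Xdeg (Δ n j : ℕ) (c : TClass Δ n) : ℕ :=
  vcount j (Quotient.out c).1

/-- Probability of an event under the uniform measure on iso classes of `Δ`-trees. -/
noncomputable def prob (Δ n : ℕ) (P : TClass Δ n → Prop) : ℝ :=
  (Nat.card {c : TClass Δ n // P c} : ℝ) / (Nat.card (TClass Δ n) : ℝ)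

/-- Expectation under the uniform measure on iso classes of `Δ`-trees. -/
noncomputable def mean (Δ n : ℕ) (f : TClass Δ n → ℝ) : ℝ :=
  (∑ᶠ c : TClass Δ n, f c) / (Nat.card (TClass Δ n) : ℝ)

/-- Variance under the uniform measure on iso classes of `Δ`-trees. -/
noncomputable def variance (Δ n : ℕ) (f : TClass Δ n → ℝ) : ℝ :=
  (∑ᶠ c : TClass Δ n, (f c - mean Δ n f) ^ 2) / (Nat.card (TClass Δ n) : ℝ)

/-- The standard normal distribution function. -/
noncomputable def stdNormalCDF (t : ℝ) : ℝ :=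
  (Real.sqrt (2 * Real.pi))⁻¹ * ∫ s in Set.Iic t, Real.exp (-(s ^ 2) / 2)

end TreePaper

namespace TreePaper

/-- The general Zagreb index `D_α(G) = Σ_v (deg v)^α` of a graph on `Fin n`. -/
noncomputable def zagreb {n : ℕ} (α : ℝ) (G : SimpleGraph (Fin n)) : ℝ :=
  ∑ v : Fin n, (degr G v : ℝ) ^ α

section Enumeration

open scoped ENNReal

/-- The enumeration of the primes in increasing order. -/
noncomputable def primeEquiv : ℕ ≃ Nat.Primes :=
  Equiv.ofBijective (fun n => ⟨Nat.nth Nat.Prime n, Nat.prime_nth_prime n⟩)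
    ⟨fun _ _ h => Nat.nth_injective Nat.infinite_setOfPred_prime (Subtype.ext_iff.1 h),
      fun p => ⟨Nat.count Nat.Prime p.1, Subtype.ext (Nat.nth_count p.2)⟩⟩

/-- A coding of finite multisets of naturals by naturals (Matula numbering): `n` codes the
multiset of prime factors of `n + 1`, each prime being named by its index. Rooted trees without
labels are thereby coded by naturals, a tree being identified with the multiset of its branches. -/
noncomputable def nodeEquiv : Multiset ℕ ≃ ℕ :=
  (show Multiset ℕ ≃ PrimeMultiset from
    { toFun := Multiset.map primeEquiv
      invFun := Multiset.map primeEquiv.symm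
      left_inv := fun s => by simp
      right_inv := fun s => (Multiset.map_map _ _ _).trans <| by
        simp only [Equiv.self_comp_symm]
        exact Multiset.map_id s }).trans
  (PNat.factorMultisetEquiv.symm.trans Equiv.pnatEquivNat)

theorem nodeEquiv_add_one (M : Multiset ℕ) :
    nodeEquiv M + 1 = (M.map (Nat.nth Nat.Prime)).prod := by
  let v : PrimeMultiset := M.map primeEquiv
  have h : nodeEquiv M + 1 = (v.prod : ℕ) := Nat.succ_pred_eq_of_pos (PNat.pos _)
  rw [h, PrimeMultiset.coe_prod]
  exact congrArg Multiset.prod (Multiset.map_map (fun p : Nat.Primes => (p : ℕ)) primeEquiv M)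

theorem lt_nodeEquiv_of_mem {k : ℕ} {M : Multiset ℕ} (h : k ∈ M) : k < nodeEquiv M := by
  have h1 : Nat.nth Nat.Prime k ∣ nodeEquiv M + 1 := by
    rw [nodeEquiv_add_one]
    exact Multiset.dvd_prod (Multiset.mem_map_of_mem _ h)
  have := Nat.le_of_dvd (Nat.succ_pos _) h1
  have := Nat.add_two_le_nth_prime k
  omega

/-- The multiset of branches at the root of the rooted tree coded by `n`. -/
noncomputable def children (n : ℕ) : Multiset ℕ := nodeEquiv.symm n

theorem lt_of_mem_children {k n : ℕ} (h : k ∈ children n) : k < n := by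
  simpa [children] using lt_nodeEquiv_of_mem h

@[simp] theorem children_nodeEquiv (M : Multiset ℕ) : children (nodeEquiv M) = M := by
  simp [children]

/-- The multiset of degrees of the vertices of the planted tree coded by `n`: the root carries an
additional edge, so that the degree of every vertex is one more than its number of children. -/
noncomputable def degs (n : ℕ) : Multiset ℕ :=
  (children n).card.succ ::ₘ ((children n).attach.map fun k => degs k.1).sum
termination_by n
decreasing_by exact lt_of_mem_children k.2

theorem degs_eq (n : ℕ) :
    degs n = ((children n).card + 1) ::ₘ ((children n).map degs).sum := by
  rw [degs, Multiset.attach_map_val' (children n) degs]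

theorem degs_nodeEquiv (M : Multiset ℕ) :
    degs (nodeEquiv M) = (M.card + 1) ::ₘ (M.map degs).sum := by
  rw [degs_eq, children_nodeEquiv]

theorem one_le_of_mem_degs {d n : ℕ} (h : d ∈ degs n) : 1 ≤ d := by
  induction n using Nat.strong_induction_on with
  | _ n ih =>
    rw [degs_eq, Multiset.mem_cons] at h
    rcases h with rfl | h
    · omega
    · obtain ⟨s, hs, hd⟩ := Multiset.mem_join.1 h
      obtain ⟨k, hk, rfl⟩ := Multiset.mem_map.1 hs
      exact ih k (lt_of_mem_children hk) hd

section Newton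

variable (u : ℕ → ℝ≥0∞)

/-- The sum of the products of the weights `u` over all multisets of cardinality `j`. -/
noncomputable def hsum (j : ℕ) : ℝ≥0∞ :=
  ∑' M : Multiset ℕ, if M.card = j then (M.map u).prod else 0

theorem hsum_zero : hsum u 0 = 1 := by
  rw [hsum, tsum_eq_single 0]
  · simp
  · intro M hM
    simp [hM]

theorem card_eq_tsum (M : Multiset ℕ) :
    (M.card : ℝ≥0∞) = ∑' (i : ℕ) (k : ℕ), if k + 1 ≤ M.count i then (1 : ℝ≥0∞) else 0 := by
  have h1 : ∀ i : ℕ, (∑' k : ℕ, if k + 1 ≤ M.count i then (1 : ℝ≥0∞) else 0) = M.count i := by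
    intro i
    rw [tsum_eq_sum (s := Finset.range (M.count i))]
    · rw [Finset.sum_congr rfl (g := fun _ => 1)]
      · simp
      · intro k hk
        exact if_pos (Finset.mem_range.1 hk)
    · intro k hk
      exact if_neg fun h => hk (Finset.mem_range.2 h)
  simp_rw [h1]
  rw [tsum_eq_sum (s := M.toFinset)]
  · rw [← M.toFinset_sum_count_eq]
    push_cast
    rfl
  · intro i hi
    simpa using hi

theorem tsum_count_le (i k j : ℕ) :
    (∑' M : Multiset ℕ, if k + 1 ≤ M.count i ∧ M.card = j + 1 then (M.map u).prod else 0)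
      = if k ≤ j then u i ^ (k + 1) * hsum u (j - k) else 0 := by
  have hinj : Function.Injective fun M : Multiset ℕ => M + Multiset.replicate (k + 1) i :=
    fun _ _ h => add_right_cancel h
  rw [← hinj.tsum_eq]
  · split_ifs with h
    · rw [hsum, mul_comm, ← ENNReal.tsum_mul_right]
      refine tsum_congr fun M => ?_
      have : (M.card + (k + 1) = j + 1) ↔ M.card = j - k := by omega
      have h2 : k + 1 ≤ (M + Multiset.replicate (k + 1) i).count i := by
        rw [Multiset.count_add, Multiset.count_replicate_self]
        omega
      simp only [h2, true_and, Multiset.card_add, Multiset.card_replicate, this, Multiset.map_add,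
        Multiset.map_replicate, Multiset.prod_add, Multiset.prod_replicate, ite_mul, zero_mul]
    · rw [ENNReal.tsum_eq_zero]
      intro M
      rw [if_neg]
      simp
      omega
  · intro M hM
    have : k + 1 ≤ M.count i := by
      by_contra h
      exact hM (if_neg fun h' => h h'.1)
    exact ⟨M - Multiset.replicate (k + 1) i,
      Multiset.sub_add_cancel (Multiset.le_count_iff_replicate_le.1 this)⟩

theorem newton_hsum (j : ℕ) :
    (j + 1 : ℝ≥0∞) * hsum u (j + 1) =
      ∑ k ∈ Finset.range (j + 1), (∑' i, u i ^ (k + 1)) * hsum u (j - k) := by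
  calc (j + 1 : ℝ≥0∞) * hsum u (j + 1)
      = ∑' (M : Multiset ℕ) (i : ℕ) (k : ℕ),
          if k + 1 ≤ M.count i ∧ M.card = j + 1 then (M.map u).prod else 0 := by
        rw [hsum, ← ENNReal.tsum_mul_left]
        refine tsum_congr fun M => ?_
        split_ifs with h
        · have : (j + 1 : ℝ≥0∞) = M.card := by rw [h]; push_cast; rfl
          rw [this, card_eq_tsum, ← ENNReal.tsum_mul_right]
          refine tsum_congr fun i => ?_
          rw [← ENNReal.tsum_mul_right]
          refine tsum_congr fun k => ?_
          simp [h]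
        · simp [h]
    _ = ∑' (k : ℕ) (i : ℕ) (M : Multiset ℕ),
          if k + 1 ≤ M.count i ∧ M.card = j + 1 then (M.map u).prod else 0 := by
        rw [ENNReal.tsum_comm]
        simp_rw [fun i => ENNReal.tsum_comm (f := fun (M : Multiset ℕ) (k : ℕ) =>
          if k + 1 ≤ M.count i ∧ M.card = j + 1 then (M.map u).prod else 0)]
        rw [ENNReal.tsum_comm]
    _ = _ := by
        simp_rw [tsum_count_le]
        rw [tsum_eq_sum (s := Finset.range (j + 1))]
        · refine Finset.sum_congr rfl fun k hk => ?_
          rw [← ENNReal.tsum_mul_right]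
          simp [Nat.lt_succ_iff.1 (Finset.mem_range.1 hk)]
        · intro k hk
          have : ¬ k ≤ j := by simpa [Nat.lt_succ_iff] using hk
          simp [this]

end Newton

/-- The complete homogeneous symmetric functions as polynomials in the power sums `p`, defined by
Newton's identities. -/
noncomputable def newtonH (p : ℕ → ℝ≥0∞) : ℕ → ℝ≥0∞
  | 0 => 1
  | j + 1 => (j + 1 : ℝ≥0∞)⁻¹ * ∑ k : Fin (j + 1), p (k + 1) * newtonH p (j - k)

theorem hsum_eq_newtonH (u : ℕ → ℝ≥0∞) (j : ℕ) :
    hsum u j = newtonH (fun k => ∑' i, u i ^ k) j := by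
  induction j using Nat.strong_induction_on with
  | _ j ih =>
    cases j with
    | zero => rw [hsum_zero, newtonH]
    | succ j =>
      have h := newton_hsum u j
      rw [newtonH, Fin.sum_univ_eq_sum_range
        (fun k => (∑' i, u i ^ (k + 1)) * newtonH (fun k => ∑' i, u i ^ k) (j - k))]
      have h2 : ∀ k ∈ Finset.range (j + 1), (∑' i, u i ^ (k + 1)) * hsum u (j - k)
          = (∑' i, u i ^ (k + 1)) * newtonH (fun k => ∑' i, u i ^ k) (j - k) := by
        intro k _
        rw [ih (j - k) (by omega)]
      rw [← Finset.sum_congr rfl h2, ← h, ← mul_assoc, ENNReal.inv_mul_cancel, one_mul]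
      · simp
      · simp

theorem newtonH_mono {p q : ℕ → ℝ≥0∞} (h : ∀ k, 1 ≤ k → p k ≤ q k) (j : ℕ) :
    newtonH p j ≤ newtonH q j := by
  induction j using Nat.strong_induction_on with
  | _ j ih =>
    cases j with
    | zero => simp [newtonH]
    | succ j =>
      rw [newtonH, newtonH]
      gcongr with k _
      · exact h _ (by omega)
      · exact ih _ (by omega)

theorem newtonH_pow (y : ℝ≥0∞) (j : ℕ) : newtonH (fun k => y ^ k) j = y ^ j := by
  induction j using Nat.strong_induction_on with
  | _ j ih =>
    cases j with
    | zero => simp [newtonH]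
    | succ j =>
      rw [newtonH]
      have : ∀ k : Fin (j + 1), y ^ (k.1 + 1) * newtonH (fun k => y ^ k) (j - k) = y ^ (j + 1) := by
        intro k
        rw [ih _ (by omega), ← pow_add]
        congr 1
        omega
      simp_rw [this]
      simp only [Finset.sum_const, Finset.card_univ, Fintype.card_fin, nsmul_eq_mul]
      rw [← mul_assoc]
      push_cast
      rw [ENNReal.inv_mul_cancel (by simp) (by simp), one_mul]

theorem newtonH_one (p : ℕ → ℝ≥0∞) : newtonH p 1 = p 1 := by
  simp [newtonH]

theorem sq_le_newtonH_two (p : ℕ → ℝ≥0∞) : p 1 ^ 2 / 2 ≤ newtonH p 2 := by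
  rw [newtonH, Fin.sum_univ_two]
  simp only [Fin.val_zero, Fin.val_one, newtonH_one, Nat.sub_zero, zero_add]
  rw [ENNReal.div_eq_inv_mul, sq]
  norm_num
  gcongr
  exact le_self_add

/-- The weight of the planted tree coded by `n`, when a vertex of degree `d` has weight `φ d`. -/
noncomputable def weight (φ : ℕ → ℝ≥0∞) (n : ℕ) : ℝ≥0∞ := ((degs n).map φ).prod

/-- The total weight of all planted trees. -/
noncomputable def totalWeight (φ : ℕ → ℝ≥0∞) : ℝ≥0∞ := ∑' n, weight φ n

theorem weight_nodeEquiv (φ : ℕ → ℝ≥0∞) (M : Multiset ℕ) :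
    weight φ (nodeEquiv M) = φ (M.card + 1) * (M.map (weight φ)).prod := by
  have h : ∀ S : Multiset (Multiset ℕ),
      (S.sum.map φ).prod = (S.map fun s => (s.map φ).prod).prod := by
    intro S
    induction S using Multiset.induction_on with
    | empty => simp
    | cons s S ih => simp [ih]
  rw [weight, degs_nodeEquiv, Multiset.map_cons, Multiset.prod_cons, h, Multiset.map_map]
  rfl

theorem weight_pow (φ : ℕ → ℝ≥0∞) (k n : ℕ) :
    weight φ n ^ k = weight (fun d => φ d ^ k) n := by
  rw [weight, weight, Multiset.prod_map_pow]

theorem tsum_card_mul_prod {Δ : ℕ} {φ : ℕ → ℝ≥0∞} (hφ : ∀ d, Δ < d → φ d = 0)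
    (v : ℕ → ℝ≥0∞) :
    ∑' M : Multiset ℕ, φ (M.card + 1) * (M.map v).prod
      = ∑ j ∈ Finset.range Δ, φ (j + 1) * newtonH (fun k => ∑' i, v i ^ k) j := by
  simp_rw [← hsum_eq_newtonH, hsum, ← ENNReal.tsum_mul_left]
  rw [← Summable.tsum_finsetSum fun _ _ => ENNReal.summable]
  refine tsum_congr fun M => ?_
  simp only [mul_ite, mul_zero, Finset.sum_ite_eq, Finset.mem_range]
  split_ifs with h
  · rfl
  · rw [hφ _ (by omega), zero_mul]

theorem totalWeight_eq {Δ : ℕ} {φ : ℕ → ℝ≥0∞} (hφ : ∀ d, Δ < d → φ d = 0) :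
    totalWeight φ = ∑ j ∈ Finset.range Δ,
      φ (j + 1) * newtonH (fun k => totalWeight fun d => φ d ^ k) j := by
  have h := tsum_card_mul_prod hφ (weight φ)
  simp_rw [weight_pow, ← weight_nodeEquiv] at h
  rw [nodeEquiv.tsum_eq] at h
  exact h

theorem sum_weight_succ_le {Δ : ℕ} {φ : ℕ → ℝ≥0∞} (hφ : ∀ d, Δ < d → φ d = 0)
    (N : ℕ) :
    ∑ n ∈ Finset.range (N + 1), weight φ n ≤ ∑ j ∈ Finset.range Δ,
      φ (j + 1) * newtonH (fun k => ∑ n ∈ Finset.range N, weight φ n ^ k) j := by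
  have h := tsum_card_mul_prod hφ (fun n => if n < N then weight φ n else 0)
  have h1 : ∑ n ∈ Finset.range (N + 1), weight φ n
      = ∑' n, if n < N + 1 then weight φ n else 0 := by
    rw [tsum_eq_sum (s := Finset.range (N + 1))]
    · exact Finset.sum_congr rfl fun n hn => (if_pos (Finset.mem_range.1 hn)).symm
    · exact fun n hn => if_neg fun h => hn (Finset.mem_range.2 h)
  rw [h1, ← nodeEquiv.tsum_eq]
  calc _ ≤ _ := ENNReal.tsum_le_tsum fun M => ?_
    _ = _ := h
    _ ≤ _ := ?_
  · split_ifs with hM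
    · rw [weight_nodeEquiv]
      refine le_of_eq ?_
      congr 2
      refine Multiset.map_congr rfl fun i hi => ?_
      have := lt_nodeEquiv_of_mem hi
      rw [if_pos (by omega)]
    · exact zero_le
  · gcongr with j _
    refine newtonH_mono (fun k hk => ?_) j
    rw [tsum_eq_sum (s := Finset.range N)]
    · exact Finset.sum_le_sum fun n hn => by rw [if_pos (Finset.mem_range.1 hn)]
    · intro n hn
      rw [if_neg fun h => hn (Finset.mem_range.2 h), zero_pow (by omega)]

theorem totalWeight_le_of_forall {Δ : ℕ} {φ : ℕ → ℝ≥0∞} (hφ : ∀ d, Δ < d → φ d = 0)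
    {p : ℕ → ℝ≥0∞}
    (hp : ∀ k, 2 ≤ k → ∀ N, ∑ n ∈ Finset.range N, weight φ n ≤ p 1 →
      ∑ n ∈ Finset.range N, weight φ n ^ k ≤ p k)
    (h : ∑ j ∈ Finset.range Δ, φ (j + 1) * newtonH p j ≤ p 1) :
    totalWeight φ ≤ p 1 := by
  have hN : ∀ N, ∑ n ∈ Finset.range N, weight φ n ≤ p 1 := by
    intro N
    induction N with
    | zero => simp
    | succ N ih =>
      refine (sum_weight_succ_le hφ N).trans (le_trans ?_ h)
      gcongr with j _
      refine newtonH_mono (fun k hk => ?_) j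
      rcases hk.eq_or_lt with rfl | hk
      · simpa using ih
      · exact hp k hk N ih
  rw [totalWeight, ENNReal.tsum_eq_iSup_nat]
  exact iSup_le hN

theorem totalWeight_le {Δ : ℕ} {φ : ℕ → ℝ≥0∞} (hφ : ∀ d, Δ < d → φ d = 0)
    {p : ℕ → ℝ≥0∞} (hp : ∀ k, 2 ≤ k → totalWeight (fun d => φ d ^ k) ≤ p k)
    (h : ∑ j ∈ Finset.range Δ, φ (j + 1) * newtonH p j ≤ p 1) :
    totalWeight φ ≤ p 1 := by
  refine totalWeight_le_of_forall hφ (fun k hk N _ => le_trans ?_ (hp k hk)) h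
  simp_rw [weight_pow]
  exact ENNReal.sum_le_tsum _

theorem totalWeight_le_of_sum_pow_le {Δ : ℕ} {φ : ℕ → ℝ≥0∞} (hφ : ∀ d, Δ < d → φ d = 0)
    {y : ℝ≥0∞} (h : ∑ j ∈ Finset.range Δ, φ (j + 1) * y ^ j ≤ y) :
    totalWeight φ ≤ y := by
  have := totalWeight_le_of_forall hφ (p := fun k => y ^ k) ?_ ?_
  · simpa using this
  · intro k hk N hN
    simp only [pow_one] at hN
    calc ∑ n ∈ Finset.range N, weight φ n ^ k
        ≤ (∑ n ∈ Finset.range N, weight φ n) ^ k := by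
          obtain ⟨k, rfl⟩ := Nat.exists_eq_add_of_le' hk
          calc _ = ∑ n ∈ Finset.range N, weight φ n * weight φ n ^ (k + 1) := by
                simp_rw [← pow_succ']
            _ ≤ ∑ n ∈ Finset.range N, weight φ n *
                  (∑ n ∈ Finset.range N, weight φ n) ^ (k + 1) := by
                gcongr with n hn
                exact Finset.single_le_sum (f := weight φ) (fun _ _ => zero_le) hn
            _ = _ := by rw [← Finset.sum_mul, ← pow_succ']
      _ ≤ y ^ k := by gcongr
  · simpa [newtonH_pow] using h

/-- The uniform weight `x` on the degrees at most `Δ`. -/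
noncomputable def unifWeight (Δ : ℕ) (x : ℝ≥0∞) (d : ℕ) : ℝ≥0∞ := if d ≤ Δ then x else 0

theorem unifWeight_of_lt {Δ : ℕ} (x : ℝ≥0∞) {d : ℕ} (h : Δ < d) : unifWeight Δ x d = 0 :=
  if_neg (by omega)

/-- The codes of the planted trees with `m` vertices of degree at most `Δ`. -/
def planted (Δ m : ℕ) : Set ℕ := {n | (degs n).card = m ∧ ∀ d ∈ degs n, d ≤ Δ}

theorem weight_unifWeight {Δ m n : ℕ} (x : ℝ≥0∞) (h : n ∈ planted Δ m) :
    weight (unifWeight Δ x) n = x ^ m := by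
  have : (degs n).map (unifWeight Δ x) = Multiset.replicate m x := by
    rw [← h.1]
    refine (Multiset.map_congr rfl fun d hd => if_pos (h.2 d hd)).trans (Multiset.map_const _ _)
  rw [weight, this, Multiset.prod_replicate]

theorem weight_eq_zero {Δ n : ℕ} {φ : ℕ → ℝ≥0∞} (hφ : ∀ d, Δ < d → φ d = 0)
    (h : n ∉ planted Δ (degs n).card) : weight φ n = 0 := by
  simp only [planted, Set.mem_ofPred_eq, true_and, not_forall, not_le] at h
  obtain ⟨d, hd, hd'⟩ := h
  exact Multiset.prod_eq_zero (Multiset.mem_map.2 ⟨d, hd, hφ d hd'⟩)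

theorem totalWeight_unifWeight_inv_ne_top (Δ : ℕ) (hΔ : 3 ≤ Δ) :
    totalWeight (unifWeight Δ (Δ : ℝ≥0∞)⁻¹) ≠ ⊤ := by
  refine ne_top_of_le_ne_top ENNReal.one_ne_top
    (totalWeight_le_of_sum_pow_le (fun d => unifWeight_of_lt _) ?_)
  have : ∀ j ∈ Finset.range Δ, unifWeight Δ (Δ : ℝ≥0∞)⁻¹ (j + 1) * 1 ^ j = (Δ : ℝ≥0∞)⁻¹ := by
    intro j hj
    rw [one_pow, mul_one]
    exact if_pos (Finset.mem_range.1 hj)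
  rw [Finset.sum_congr rfl this]
  simp only [Finset.sum_const, Finset.card_range, nsmul_eq_mul]
  rw [ENNReal.mul_inv_cancel (by simp; omega) (by simp)]

theorem le_totalWeight_unifWeight {Δ : ℕ} (hΔ : 3 ≤ Δ) (x : ℝ≥0∞) :
    x + x * totalWeight (unifWeight Δ x) + x * (totalWeight (unifWeight Δ x) ^ 2 / 2)
      ≤ totalWeight (unifWeight Δ x) := by
  set p : ℕ → ℝ≥0∞ := fun k => totalWeight fun d => unifWeight Δ x d ^ k with hp
  have h1 : p 1 = totalWeight (unifWeight Δ x) := by simp [hp]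
  conv_rhs => rw [totalWeight_eq fun d hd => unifWeight_of_lt (Δ := Δ) x hd]
  rw [← Finset.sum_range_add_sum_Ico _ hΔ]
  refine le_trans ?_ le_self_add
  have h2 : ∀ j ∈ Finset.range 3, unifWeight Δ x (j + 1) = x := by
    intro j hj
    have := Finset.mem_range.1 hj
    exact if_pos (by omega)
  rw [Finset.sum_congr rfl fun j hj => by rw [h2 j hj], Finset.sum_range_succ,
    Finset.sum_range_succ, Finset.sum_range_one, newtonH_one, ← h1]
  change _ ≤ x * newtonH p 0 + x * p 1 + x * newtonH p 2
  gcongr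
  · simp [newtonH]
  · exact sq_le_newtonH_two p

theorem mul_totalWeight_unifWeight_le {Δ : ℕ} (hΔ : 3 ≤ Δ) {x : ℝ≥0∞}
    (h : totalWeight (unifWeight Δ x) ≠ ⊤) : x * totalWeight (unifWeight Δ x) ≤ 2 := by
  set P := totalWeight (unifWeight Δ x) with hP
  have h1 : x * (P ^ 2 / 2) ≤ P := le_add_self.trans (le_totalWeight_unifWeight hΔ x)
  by_cases h0 : P = 0
  · simp [h0]
  have h2 : x * P * P ≤ 2 * P := by
    calc x * P * P = 2 * (x * (P ^ 2 / 2)) := by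
          rw [ENNReal.div_eq_inv_mul, mul_left_comm x, ← mul_assoc 2,
            ENNReal.mul_inv_cancel (by simp) (by simp), one_mul, sq, mul_assoc]
      _ ≤ 2 * P := by gcongr
  exact (ENNReal.mul_le_mul_iff_left h0 h).1 h2

theorem totalWeight_unifWeight_half {Δ : ℕ} (hΔ : 3 ≤ Δ) {x : ℝ≥0∞} (hx : 2⁻¹ ≤ x) :
    totalWeight (unifWeight Δ x) = ⊤ := by
  by_contra h
  have h1 := le_totalWeight_unifWeight hΔ x
  set P := totalWeight (unifWeight Δ x) with hP
  have h2 : 2⁻¹ + 2⁻¹ * P + 2⁻¹ * (P ^ 2 / 2) ≤ P := le_trans (by gcongr) h1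
  obtain ⟨y, hy⟩ : ∃ y : NNReal, P = y := ⟨P.toNNReal, (ENNReal.coe_toNNReal h).symm⟩
  rw [hy] at h2
  have h3 : (2 : NNReal)⁻¹ + 2⁻¹ * y + 2⁻¹ * (y ^ 2 / 2) ≤ y := by
    have h4 : (2 : ℝ≥0∞) = ((2 : NNReal) : ℝ≥0∞) := rfl
    rw [h4, ← ENNReal.coe_inv (by norm_num), ← ENNReal.coe_pow, ← ENNReal.coe_div (by norm_num)] at h2
    exact_mod_cast h2
  have h5 : (2 : ℝ)⁻¹ + 2⁻¹ * y + 2⁻¹ * (y ^ 2 / 2) ≤ y := by exact_mod_cast h3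
  nlinarith [sq_nonneg ((y : ℝ) - 1)]

/-- The radius of convergence of the generating function of planted trees with degrees at most
`Δ`. -/
noncomputable def radius (Δ : ℕ) : ℝ≥0∞ := sSup {x | totalWeight (unifWeight Δ x) ≠ ⊤}

theorem radius_le {Δ : ℕ} (hΔ : 3 ≤ Δ) : radius Δ ≤ 2⁻¹ := by
  refine sSup_le fun x hx => ?_
  by_contra h
  exact hx (totalWeight_unifWeight_half hΔ (not_le.1 h).le)

theorem radius_pos {Δ : ℕ} (hΔ : 3 ≤ Δ) : 0 < radius Δ :=
  lt_of_lt_of_le (by simp) (le_sSup (totalWeight_unifWeight_inv_ne_top Δ hΔ))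

theorem totalWeight_unifWeight_of_radius_lt {Δ : ℕ} {x : ℝ≥0∞} (h : radius Δ < x) :
    totalWeight (unifWeight Δ x) = ⊤ := by
  by_contra h'
  exact (le_sSup (a := x) h').not_gt h

theorem weight_mono {φ ψ : ℕ → ℝ≥0∞} (h : ∀ d, 1 ≤ d → φ d ≤ ψ d) (n : ℕ) :
    weight φ n ≤ weight ψ n := by
  unfold weight
  have : ∀ s : Multiset ℕ, (∀ d ∈ s, 1 ≤ d) → (s.map φ).prod ≤ (s.map ψ).prod := by
    intro s
    induction s using Multiset.induction_on with
    | empty => simp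
    | cons d s ih =>
      intro hs
      simp only [Multiset.map_cons, Multiset.prod_cons]
      exact mul_le_mul' (h d (hs d (by simp))) (ih fun d hd => hs d (by simp [hd]))
  exact this _ fun d hd => one_le_of_mem_degs hd

theorem totalWeight_unifWeight_radius_ne_top {Δ : ℕ} (hΔ : 3 ≤ Δ) :
    totalWeight (unifWeight Δ (radius Δ)) ≠ ⊤ := by
  have key : ∀ s : Finset ℕ, radius Δ * ∑ n ∈ s, weight (unifWeight Δ (radius Δ)) n ≤ 2 := by
    intro s
    have hcl : IsClosed {x : ℝ≥0∞ | x * ∑ n ∈ s, weight (unifWeight Δ x) n ≤ 2} := by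
      refine isClosed_le ?_ continuous_const
      simp_rw [Finset.mul_sum]
      refine continuous_finsetSum _ fun n _ => ?_
      by_cases hn : n ∈ planted Δ (degs n).card
      · simp_rw [weight_unifWeight _ hn, ← pow_succ']
        exact ENNReal.continuous_pow _
      · simp_rw [weight_eq_zero (fun d => unifWeight_of_lt _) hn, mul_zero]
        exact continuous_const
    refine hcl.closure_subset_iff.2 ?_
      (sSup_mem_closure ⟨_, totalWeight_unifWeight_inv_ne_top Δ hΔ⟩)
    intro x hx
    refine le_trans ?_ (mul_totalWeight_unifWeight_le hΔ hx)
    gcongr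
    exact ENNReal.sum_le_tsum s
  have h2 : radius Δ * totalWeight (unifWeight Δ (radius Δ)) ≤ 2 := by
    rw [totalWeight, ENNReal.tsum_eq_iSup_sum, ENNReal.mul_iSup]
    exact iSup_le key
  intro h
  rw [h, ENNReal.mul_top (radius_pos hΔ).ne'] at h2
  simp at h2

theorem finite_planted {Δ : ℕ} (hΔ : 3 ≤ Δ) (m : ℕ) : (planted Δ m).Finite := by
  refine (ENNReal.finite_const_le_of_tsum_ne_top
    (totalWeight_unifWeight_radius_ne_top hΔ) (ε := radius Δ ^ m)
    (pow_ne_zero _ (radius_pos hΔ).ne')).subset fun n hn => ?_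
  exact (weight_unifWeight _ hn).ge

theorem summable_mul_of_summable_exp {a b : ℕ → ℝ} (ha : ∀ n, 0 ≤ a n) {s : ℝ} (hs : 0 < s)
    (h : Summable fun n => a n * Real.exp (s * |b n|)) : Summable fun n => a n * b n := by
  refine Summable.of_norm_bounded (h.mul_left s⁻¹) fun n => ?_
  rw [norm_mul, Real.norm_of_nonneg (ha n), Real.norm_eq_abs, mul_left_comm]
  refine mul_le_mul_of_nonneg_left ?_ (ha n)
  rw [inv_mul_eq_div, le_div_iff₀ hs, mul_comm]
  linarith [Real.add_one_le_exp (s * |b n|)]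

theorem hasDerivAt_tsum_mul_exp {a b : ℕ → ℝ} (ha : ∀ n, 0 ≤ a n) {s : ℝ} (hs : 0 < s)
    (h : Summable fun n => a n * Real.exp (s * |b n|)) :
    HasDerivAt (fun t => ∑' n, a n * Real.exp (t * b n)) (∑' n, a n * b n) 0 := by
  have key := hasDerivAt_tsum_of_isPreconnected (𝕜 := ℝ) (F := ℝ)
    (g := fun n t => a n * Real.exp (t * b n))
    (g' := fun n t => a n * (Real.exp (t * b n) * (1 * b n)))
    (u := fun n => (s / 2)⁻¹ * (a n * Real.exp (s * |b n|)))
    (t := Metric.ball 0 (s / 2)) (y₀ := 0) (y := 0) (h.mul_left _) Metric.isOpen_ball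
    (convex_ball _ _).isPreconnected
    (fun n t _ => (((hasDerivAt_id t).mul_const (b n)).exp).const_mul (a n)) ?_
    (Metric.mem_ball_self (by positivity)) ?_ (Metric.mem_ball_self (by positivity))
  · simpa using key
  · intro n t ht
    rw [mem_ball_zero_iff, Real.norm_eq_abs] at ht
    rw [norm_mul, Real.norm_of_nonneg (ha n), mul_left_comm (s / 2)⁻¹]
    refine mul_le_mul_of_nonneg_left ?_ (ha n)
    rw [one_mul, norm_mul, Real.norm_eq_abs, Real.norm_eq_abs, Real.abs_exp]
    have h1 : Real.exp (t * b n) ≤ Real.exp (s / 2 * |b n|) := by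
      refine Real.exp_le_exp.2 ?_
      calc t * b n ≤ |t * b n| := le_abs_self _
        _ = |t| * |b n| := abs_mul _ _
        _ ≤ _ := by gcongr
    have h2 : |b n| ≤ (s / 2)⁻¹ * Real.exp (s / 2 * |b n|) := by
      rw [inv_mul_eq_div, le_div_iff₀ (by positivity), mul_comm]
      linarith [Real.add_one_le_exp (s / 2 * |b n|)]
    calc Real.exp (t * b n) * |b n|
        ≤ Real.exp (s / 2 * |b n|) * ((s / 2)⁻¹ * Real.exp (s / 2 * |b n|)) := by gcongr
      _ = (s / 2)⁻¹ * Real.exp (s * |b n|) := by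
        rw [mul_left_comm, ← Real.exp_add]
        ring_nf
  · simp only [zero_mul, Real.exp_zero, mul_one]
    refine Summable.of_nonneg_of_le ha (fun n => ?_) h
    exact le_mul_of_one_le_right (ha n) (Real.one_le_exp (by positivity))

/-- A family of functions of `t`, indexed by a slope `δ`, with common value at `0` and whose
derivative `A - δ * B` at `0` is an affine nonincreasing function of the slope. -/
structure AffineDeriv (g : ℝ → ℝ → ℝ≥0∞) (v A B : ℝ) : Prop where
  nonneg : 0 ≤ B
  ne_top : ∀ δ, ∀ᶠ t in 𝓝 0, g δ t ≠ ⊤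
  apply_zero : ∀ δ, (g δ 0).toReal = v
  hasDerivAt : ∀ δ, HasDerivAt (fun t => (g δ t).toReal) (A - δ * B) 0

namespace AffineDeriv

variable {g g' : ℝ → ℝ → ℝ≥0∞} {v v' A A' B B' : ℝ}

theorem value_nonneg (h : AffineDeriv g v A B) : 0 ≤ v := by
  rw [← h.apply_zero 0]
  exact ENNReal.toReal_nonneg

protected theorem const {c : ℝ≥0∞} (hc : c ≠ ⊤) : AffineDeriv (fun _ _ => c) c.toReal 0 0 where
  nonneg := le_rfl
  ne_top _ := Eventually.of_forall fun _ => hc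
  apply_zero _ := rfl
  hasDerivAt δ := by simpa using hasDerivAt_const (0 : ℝ) c.toReal

theorem add (h : AffineDeriv g v A B) (h' : AffineDeriv g' v' A' B') :
    AffineDeriv (fun δ t => g δ t + g' δ t) (v + v') (A + A') (B + B') where
  nonneg := add_nonneg h.nonneg h'.nonneg
  ne_top δ := by
    filter_upwards [h.ne_top δ, h'.ne_top δ] with t h1 h2
    exact ENNReal.add_ne_top.2 ⟨h1, h2⟩
  apply_zero δ := by
    rw [ENNReal.toReal_add (h.ne_top δ).self_of_nhds (h'.ne_top δ).self_of_nhds, h.apply_zero,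
      h'.apply_zero]
  hasDerivAt δ := by
    have h3 := (h.hasDerivAt δ).add (h'.hasDerivAt δ)
    have h4 : A + A' - δ * (B + B') = A - δ * B + (A' - δ * B') := by ring
    rw [h4]
    refine h3.congr_of_eventuallyEq ?_
    filter_upwards [h.ne_top δ, h'.ne_top δ] with t h1 h2
    exact ENNReal.toReal_add h1 h2

theorem mul (h : AffineDeriv g v A B) (h' : AffineDeriv g' v' A' B') :
    AffineDeriv (fun δ t => g δ t * g' δ t) (v * v') (A * v' + v * A') (B * v' + v * B') where
  nonneg := add_nonneg (mul_nonneg h.nonneg h'.value_nonneg) (mul_nonneg h.value_nonneg h'.nonneg)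
  ne_top δ := by
    filter_upwards [h.ne_top δ, h'.ne_top δ] with t h1 h2
    exact ENNReal.mul_ne_top h1 h2
  apply_zero δ := by rw [ENNReal.toReal_mul, h.apply_zero, h'.apply_zero]
  hasDerivAt δ := by
    have h3 := (h.hasDerivAt δ).mul (h'.hasDerivAt δ)
    rw [h.apply_zero, h'.apply_zero] at h3
    have h4 : A * v' + v * A' - δ * (B * v' + v * B')
        = (A - δ * B) * v' + v * (A' - δ * B') := by ring
    rw [h4]
    refine h3.congr_of_eventuallyEq (Eventually.of_forall fun t => ?_)
    exact ENNReal.toReal_mul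

theorem exists_sum {ι : Type*} (s : Finset ι) {G : ι → ℝ → ℝ → ℝ≥0∞}
    (h : ∀ i ∈ s, ∃ v A B, AffineDeriv (G i) v A B) :
    ∃ v A B, AffineDeriv (fun δ t => ∑ i ∈ s, G i δ t) v A B := by
  classical
  induction s using Finset.induction_on with
  | empty => exact ⟨_, _, _, by simpa using AffineDeriv.const ENNReal.zero_ne_top⟩
  | insert i s hi ih =>
    obtain ⟨v, A, B, h1⟩ := ih fun j hj => h j (Finset.mem_insert_of_mem hj)
    obtain ⟨v', A', B', h2⟩ := h i (Finset.mem_insert_self _ _)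
    simp_rw [Finset.sum_insert hi]
    exact ⟨_, _, _, h2.add h1⟩

theorem exists_newtonH {p : ℝ → ℝ → ℕ → ℝ≥0∞}
    (hp : ∀ k, 1 ≤ k → ∃ v A B, AffineDeriv (fun δ t => p δ t k) v A B) (j : ℕ) :
    ∃ v A B, AffineDeriv (fun δ t => newtonH (p δ t) j) v A B := by
  induction j using Nat.strong_induction_on with
  | _ j ih =>
    cases j with
    | zero =>
      simp only [newtonH]
      exact ⟨_, _, _, AffineDeriv.const ENNReal.one_ne_top⟩
    | succ j =>
      simp only [newtonH]
      obtain ⟨v, A, B, h⟩ := exists_sum (Finset.univ : Finset (Fin (j + 1)))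
        (G := fun k δ t => p δ t (k + 1) * newtonH (p δ t) (j - k)) fun k _ => by
          obtain ⟨v, A, B, h1⟩ := hp (k + 1) (by omega)
          obtain ⟨v', A', B', h2⟩ := ih (j - k) (by omega)
          exact ⟨_, _, _, h1.mul h2⟩
      exact ⟨_, _, _, (AffineDeriv.const (by simp)).mul h⟩

end AffineDeriv

section Tilt

variable (Δ : ℕ) (f : ℕ → ℝ)

/-- The critical weights of the degrees, exponentially tilted by `t * (f d - δ)`. -/
noncomputable def tiltWeight (δ t : ℝ) (d : ℕ) : ℝ≥0∞ :=
  if d ≤ Δ then ENNReal.ofReal ((radius Δ).toReal * Real.exp (t * (f d - δ))) else 0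

/-- The sum of `f` over the degrees of the vertices of a planted tree. -/
noncomputable def stat (n : ℕ) : ℝ := ((degs n).map f).sum

variable {Δ f}

theorem tiltWeight_of_lt (δ t : ℝ) {d : ℕ} (h : Δ < d) : tiltWeight Δ f δ t d = 0 :=
  if_neg (by omega)

theorem radius_ne_top (hΔ : 3 ≤ Δ) : radius Δ ≠ ⊤ :=
  ne_top_of_le_ne_top (by simp) (radius_le hΔ)

theorem toReal_radius_pos (hΔ : 3 ≤ Δ) : 0 < (radius Δ).toReal :=
  ENNReal.toReal_pos (radius_pos hΔ).ne' (radius_ne_top hΔ)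

theorem toReal_radius_lt_one (hΔ : 3 ≤ Δ) : (radius Δ).toReal < 1 := by
  have := ENNReal.toReal_mono (by simp) (radius_le hΔ)
  rw [ENNReal.toReal_inv] at this
  norm_num at this
  linarith

theorem tiltWeight_zero (hΔ : 3 ≤ Δ) (δ : ℝ) :
    tiltWeight Δ f δ 0 = unifWeight Δ (radius Δ) := by
  ext d
  simp [tiltWeight, unifWeight, ENNReal.ofReal_toReal (radius_ne_top hΔ)]

theorem weight_tiltWeight (δ t : ℝ) {m n : ℕ} (h : n ∈ planted Δ m) :
    weight (tiltWeight Δ f δ t) n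
      = ENNReal.ofReal ((radius Δ).toReal ^ m * Real.exp (t * (stat f n - δ * m))) := by
  have key : ∀ s : Multiset ℕ, (∀ d ∈ s, d ≤ Δ) → (s.map (tiltWeight Δ f δ t)).prod
      = ENNReal.ofReal ((radius Δ).toReal ^ s.card *
          Real.exp (t * ((s.map f).sum - δ * s.card))) := by
    intro s
    induction s using Multiset.induction_on with
    | empty => simp
    | cons d s ih =>
      intro hs
      rw [Multiset.map_cons, Multiset.prod_cons, ih fun d hd => hs d (by simp [hd]), tiltWeight,
        if_pos (hs d (by simp)), ← ENNReal.ofReal_mul (by positivity), mul_mul_mul_comm,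
        ← Real.exp_add, Multiset.map_cons, Multiset.sum_cons, Multiset.card_cons, ← pow_succ']
      push_cast
      ring_nf
  rw [weight, key _ h.2, h.1, stat]

/-- The coefficients of the critical generating function of planted trees evaluated at the `k`-th
power of the radius. -/
noncomputable def critCoeff (Δ k n : ℕ) : ℝ :=
  (weight (unifWeight Δ (radius Δ ^ k)) n).toReal

theorem critCoeff_nonneg (k n : ℕ) : 0 ≤ critCoeff Δ k n := ENNReal.toReal_nonneg

theorem critCoeff_of_mem (k : ℕ) {m n : ℕ} (h : n ∈ planted Δ m) :
    critCoeff Δ k n = (radius Δ).toReal ^ (k * m) := by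
  rw [critCoeff, weight_unifWeight _ h, ← pow_mul, ENNReal.toReal_pow]

theorem critCoeff_of_notMem (k : ℕ) {n : ℕ} (h : n ∉ planted Δ (degs n).card) :
    critCoeff Δ k n = 0 := by
  rw [critCoeff, weight_eq_zero (fun d => unifWeight_of_lt _) h, ENNReal.toReal_zero]

theorem weight_tiltWeight_pow {k : ℕ} (hk : k ≠ 0) (δ t : ℝ) (n : ℕ) :
    weight (fun d => tiltWeight Δ f δ t d ^ k) n = ENNReal.ofReal
      (critCoeff Δ k n * Real.exp (t * (k * (stat f n - δ * (degs n).card)))) := by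
  rw [← weight_pow]
  by_cases h : n ∈ planted Δ (degs n).card
  · rw [weight_tiltWeight δ t h, ← ENNReal.ofReal_pow (by positivity), mul_pow, ← pow_mul,
      ← Real.exp_nat_mul, critCoeff_of_mem k h, mul_comm k]
    ring_nf
  · rw [weight_eq_zero (fun d => tiltWeight_of_lt _ _) h, critCoeff_of_notMem k h]
    simp [hk]

theorem abs_stat_le {m n : ℕ} (h : n ∈ planted Δ m) :
    |stat f n| ≤ (∑ d ∈ Finset.range (Δ + 1), |f d|) * m := by
  rw [← h.1, stat]
  have key : ∀ s : Multiset ℕ, (∀ d ∈ s, d ≤ Δ) →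
      |(s.map f).sum| ≤ (∑ d ∈ Finset.range (Δ + 1), |f d|) * s.card := by
    intro s
    induction s using Multiset.induction_on with
    | empty => simp
    | cons d s ih =>
      intro hs
      rw [Multiset.map_cons, Multiset.sum_cons, Multiset.card_cons]
      push_cast
      have h1 := ih fun d hd => hs d (by simp [hd])
      have h2 : |f d| ≤ ∑ d ∈ Finset.range (Δ + 1), |f d| :=
        Finset.single_le_sum (f := fun d => |f d|) (fun _ _ => abs_nonneg _)
          (Finset.mem_range.2 (Nat.lt_succ_of_le (hs d (by simp))))
      linarith [abs_add_le (f d) (s.map f).sum]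
  exact key _ h.2

theorem summable_critCoeff_mul_exp (hΔ : 3 ≤ Δ) {k : ℕ} (hk : 2 ≤ k) {K : ℝ} (hK : 0 < K) :
    ∃ s, 0 < s ∧ ∀ b : ℕ → ℝ, (∀ m, ∀ n ∈ planted Δ m, |b n| ≤ K * m) →
      Summable fun n => critCoeff Δ k n * Real.exp (s * |b n|) := by
  set r := (radius Δ).toReal with hr
  have hr0 : 0 < r := toReal_radius_pos hΔ
  have hr1 : r < 1 := toReal_radius_lt_one hΔ
  have hk0 : (0 : ℝ) < k := by positivity
  refine ⟨-Real.log r / K, div_pos (by simpa using Real.log_neg hr0 hr1) hK, fun b hb => ?_⟩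
  have hsum : Summable fun n => critCoeff Δ 1 n := by
    refine ENNReal.summable_toReal ?_
    rw [pow_one]
    exact totalWeight_unifWeight_radius_ne_top hΔ
  refine Summable.of_nonneg_of_le (fun n => mul_nonneg (critCoeff_nonneg _ _) (by positivity))
    (fun n => ?_) hsum
  by_cases h : n ∈ planted Δ (degs n).card
  · rw [critCoeff_of_mem _ h, critCoeff_of_mem _ h, ← hr]
    set m := (degs n).card
    have h1 : -Real.log r / K * |b n| ≤ -Real.log r * m := by
      calc -Real.log r / K * |b n| ≤ -Real.log r / K * (K * m) := by
            refine mul_le_mul_of_nonneg_left (hb m n h) (div_nonneg ?_ hK.le)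
            linarith [Real.log_neg hr0 hr1]
        _ = -Real.log r * m := by field_simp
    have h2 : r ^ (k * m) ≤ r ^ (2 * m) := pow_le_pow_of_le_one hr0.le hr1.le (by gcongr)
    have h3 : Real.exp (-Real.log r * m) = (r ^ m)⁻¹ := by
      rw [mul_comm, Real.exp_nat_mul, Real.exp_neg, Real.exp_log hr0, inv_pow]
    calc r ^ (k * m) * Real.exp (-Real.log r / K * |b n|)
        ≤ r ^ (2 * m) * (r ^ m)⁻¹ := by rw [← h3]; gcongr
      _ = r ^ (1 * m) := by
        rw [two_mul, pow_add, one_mul, mul_assoc, mul_inv_cancel₀ (by positivity), mul_one]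
  · rw [critCoeff_of_notMem _ h, critCoeff_of_notMem _ h, zero_mul]

theorem affineDeriv_totalWeight (hΔ : 3 ≤ Δ) {k : ℕ} (hk : 2 ≤ k) :
    ∃ v A B, AffineDeriv (fun δ t => totalWeight fun d => tiltWeight Δ f δ t d ^ k) v A B := by
  set C := ∑ d ∈ Finset.range (Δ + 1), |f d| with hC
  have hC0 : 0 ≤ C := Finset.sum_nonneg fun _ _ => abs_nonneg _
  have hb1 : ∀ m, ∀ n ∈ planted Δ m, |(k * (degs n).card : ℝ)| ≤ k * m := by
    intro m n h
    rw [h.1, abs_of_nonneg (by positivity)]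
  have hb2 : ∀ m, ∀ n ∈ planted Δ m, |k * stat f n| ≤ k * (C + 1) * m := by
    intro m n h
    rw [abs_mul, Nat.abs_cast, mul_assoc]
    gcongr
    refine (abs_stat_le h).trans ?_
    gcongr
    linarith
  obtain ⟨s1, hs1, h1⟩ := summable_critCoeff_mul_exp hΔ hk (K := k) (by positivity)
  obtain ⟨s2, hs2, h2⟩ := summable_critCoeff_mul_exp hΔ hk (K := k * (C + 1)) (by positivity)
  have hB := summable_mul_of_summable_exp (critCoeff_nonneg k) hs1 (h1 _ hb1)
  have hA := summable_mul_of_summable_exp (critCoeff_nonneg k) hs2 (h2 _ hb2)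
  have hW : ∀ δ t, totalWeight (fun d => tiltWeight Δ f δ t d ^ k) = ∑' n, ENNReal.ofReal
      (critCoeff Δ k n * Real.exp (t * (k * (stat f n - δ * (degs n).card)))) :=
    fun δ t => tsum_congr fun n => weight_tiltWeight_pow (by omega) δ t n
  have hW' : ∀ δ t, (totalWeight (fun d => tiltWeight Δ f δ t d ^ k)).toReal = ∑' n,
      (critCoeff Δ k n * Real.exp (t * (k * (stat f n - δ * (degs n).card)))) := by
    intro δ t
    rw [hW, ENNReal.tsum_toReal_eq fun _ => ENNReal.ofReal_ne_top]
    exact tsum_congr fun n => ENNReal.toReal_ofReal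
      (mul_nonneg (critCoeff_nonneg _ _) (Real.exp_pos _).le)
  have hs : ∀ δ : ℝ, ∃ s, 0 < s ∧ Summable fun n =>
      critCoeff Δ k n * Real.exp (s * |k * (stat f n - δ * (degs n).card)|) := by
    intro δ
    obtain ⟨s, hs, h⟩ := summable_critCoeff_mul_exp hΔ hk (K := k * (C + 1 + |δ|)) (by positivity)
    refine ⟨s, hs, h _ fun m n hn => ?_⟩
    rw [abs_mul, Nat.abs_cast, mul_assoc, hn.1]
    gcongr
    have h3 := abs_stat_le (f := f) hn
    have h4 := abs_sub (stat f n) (δ * m)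
    rw [abs_mul, Nat.abs_cast] at h4
    have : (0 : ℝ) ≤ m := by positivity
    linarith
  refine ⟨∑' n, critCoeff Δ k n, ∑' n, critCoeff Δ k n * (k * stat f n),
    ∑' n, critCoeff Δ k n * (k * (degs n).card), ?_, fun δ => ?_, fun δ => ?_, fun δ => ?_⟩
  · exact tsum_nonneg fun n => mul_nonneg (critCoeff_nonneg _ _) (by positivity)
  · obtain ⟨s, hs, h⟩ := hs δ
    filter_upwards [Metric.ball_mem_nhds 0 hs] with t ht
    rw [mem_ball_zero_iff, Real.norm_eq_abs] at ht
    rw [hW]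
    refine Summable.tsum_ofReal_ne_top (h.of_nonneg_of_le
      (fun n => mul_nonneg (critCoeff_nonneg _ _) (Real.exp_pos _).le) fun n => ?_)
    refine mul_le_mul_of_nonneg_left (Real.exp_le_exp.2 ?_) (critCoeff_nonneg _ _)
    refine (le_abs_self _).trans ?_
    rw [abs_mul]
    gcongr
  · rw [hW']
    simp
  · obtain ⟨s, hs, h⟩ := hs δ
    simp_rw [hW']
    have h5 : ∑' n, critCoeff Δ k n * (k * stat f n)
        - δ * ∑' n, critCoeff Δ k n * (k * (degs n).card)
        = ∑' n, critCoeff Δ k n * (k * (stat f n - δ * (degs n).card)) := by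
      rw [← tsum_mul_left, ← hA.tsum_sub (hB.mul_left δ)]
      exact tsum_congr fun n => by ring
    rw [h5]
    exact hasDerivAt_tsum_mul_exp (critCoeff_nonneg k) hs h

theorem affineDeriv_tiltWeight {d : ℕ} (hd : d ≤ Δ) :
    AffineDeriv (fun δ t => tiltWeight Δ f δ t d) (radius Δ).toReal
      ((radius Δ).toReal * f d) (radius Δ).toReal := by
  have h : ∀ δ t, (tiltWeight Δ f δ t d).toReal
      = (radius Δ).toReal * Real.exp (t * (f d - δ)) := by
    intro δ t
    rw [tiltWeight, if_pos hd, ENNReal.toReal_ofReal (by positivity)]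
  refine ⟨ENNReal.toReal_nonneg, fun δ => Eventually.of_forall fun t => ?_, fun δ => ?_,
    fun δ => ?_⟩
  · rw [tiltWeight, if_pos hd]
    exact ENNReal.ofReal_ne_top
  · simp [h]
  · simp_rw [h]
    have := (((hasDerivAt_id (0 : ℝ)).mul_const (f d - δ)).exp).const_mul (radius Δ).toReal
    convert! this using 1
    simp
    ring

theorem eventually_lt_of_hasDerivAt_neg {h : ℝ → ℝ} {D : ℝ} (hd : HasDerivAt h D 0)
    (hD : D < 0) : ∀ᶠ t in 𝓝[>] 0, h t < h 0 := by
  have h1 := (hasDerivAt_iff_tendsto_slope_zero.1 hd).eventually (gt_mem_nhds hD)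
  filter_upwards [h1.filter_mono (nhdsWithin_mono 0 fun t (ht : 0 < t) => ht.ne'),
    self_mem_nhdsWithin] with t ht ht0
  rw [zero_add, smul_eq_mul, inv_mul_eq_div, div_lt_iff₀ ht0, zero_mul] at ht
  linarith

/-- At the critical point, tilting in the direction of a slope slightly larger (smaller) than the
typical one, with a small positive (negative) parameter, keeps the generating function bounded. -/
theorem exists_slope (hΔ : 3 ≤ Δ) (f : ℕ → ℝ) : ∃ d : ℝ, ∀ η : ℝ, 0 < η →
    (∃ t, 0 < t ∧ totalWeight (tiltWeight Δ f (d + η) t) ≤ totalWeight (unifWeight Δ (radius Δ))) ∧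
    (∃ t, t < 0 ∧
      totalWeight (tiltWeight Δ f (d - η) t) ≤ totalWeight (unifWeight Δ (radius Δ))) := by
  set τ := totalWeight (unifWeight Δ (radius Δ)) with hτ
  have hτ_top : τ ≠ ⊤ := totalWeight_unifWeight_radius_ne_top hΔ
  set p : ℝ → ℝ → ℕ → ℝ≥0∞ := fun δ t k =>
    if k = 1 then τ else totalWeight fun d => tiltWeight Δ f δ t d ^ k with hp
  have hp1 : ∀ δ t, p δ t 1 = τ := fun _ _ => if_pos rfl
  have hpn : ∀ k, 1 ≤ k → ∃ v A B, AffineDeriv (fun δ t => p δ t k) v A B := by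
    intro k hk
    rcases hk.eq_or_lt with rfl | hk
    · simp_rw [hp1]
      exact ⟨_, _, _, AffineDeriv.const hτ_top⟩
    · have : ∀ δ t, p δ t k = totalWeight fun d => tiltWeight Δ f δ t d ^ k :=
        fun _ _ => if_neg (by omega)
      simp_rw [this]
      exact affineDeriv_totalWeight hΔ hk
  obtain ⟨v, A, B, hF⟩ := AffineDeriv.exists_sum (Finset.Ico 1 Δ)
    (G := fun j δ t => tiltWeight Δ f δ t (j + 1) * newtonH (p δ t) j) fun j hj => by
      obtain ⟨v, A, B, h⟩ := AffineDeriv.exists_newtonH hpn j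
      exact ⟨_, _, _, (affineDeriv_tiltWeight (by simp at hj; omega)).mul h⟩
  have hF' := (affineDeriv_tiltWeight (Δ := Δ) (f := f) (d := 0 + 1) (by omega)).add hF
  set F : ℝ → ℝ → ℝ≥0∞ := fun δ t =>
    ∑ j ∈ Finset.range Δ, tiltWeight Δ f δ t (j + 1) * newtonH (p δ t) j with hFdef
  have hFeq : ∀ δ t, F δ t = tiltWeight Δ f δ t (0 + 1) +
      ∑ j ∈ Finset.Ico 1 Δ, tiltWeight Δ f δ t (j + 1) * newtonH (p δ t) j := by
    intro δ t
    rw [hFdef]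
    dsimp only
    rw [Finset.range_eq_Ico, Finset.sum_eq_sum_Ico_succ_bot (by omega)]
    simp [newtonH]
  simp_rw [← hFeq] at hF'
  have hB0 : 0 < (radius Δ).toReal + B := add_pos_of_pos_of_nonneg (toReal_radius_pos hΔ) hF.nonneg
  have hF0 : ∀ δ, F δ 0 = τ := by
    intro δ
    rw [hτ, totalWeight_eq fun d hd => unifWeight_of_lt (Δ := Δ) (radius Δ) hd, hFdef]
    dsimp only
    rw [tiltWeight_zero hΔ]
    congr! 4 with j hj k
    rw [hp]
    dsimp only
    rw [tiltWeight_zero hΔ]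
    split_ifs with hk
    · simp [hk, hτ]
    · rfl
  have hle : ∀ δ t, F δ t ≤ τ → totalWeight (tiltWeight Δ f δ t) ≤ τ := by
    intro δ t h
    rw [← hp1 δ t] at h ⊢
    refine totalWeight_le (fun d hd => tiltWeight_of_lt (f := f) δ t hd) (fun k hk => ?_) h
    exact (if_neg (by omega)).ge
  have hlt : ∀ δ t, F δ t ≠ ⊤ → (F δ t).toReal < (F δ 0).toReal →
      totalWeight (tiltWeight Δ f δ t) ≤ τ := by
    intro δ t h1 h2
    refine hle δ t ?_
    rw [← hF0 δ]
    exact ((ENNReal.toReal_lt_toReal h1 (by rwa [hF0])).1 h2).le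
  set B' := (radius Δ).toReal + B
  set A' := (radius Δ).toReal * f (0 + 1) + A
  refine ⟨A' / B', fun η hη => ⟨?_, ?_⟩⟩
  · have hd := eventually_lt_of_hasDerivAt_neg (hF'.hasDerivAt (A' / B' + η)) (by
      rw [add_mul, div_mul_cancel₀ _ hB0.ne']
      linarith [mul_pos hη hB0])
    obtain ⟨t, ht1, ht2, ht3⟩ :=
      (hd.and (((hF'.ne_top _).filter_mono nhdsWithin_le_nhds).and self_mem_nhdsWithin)).exists
    exact ⟨t, ht3, hlt _ t ht2 ht1⟩
  · have hc := HasDerivAt.scomp (0 : ℝ) (g₁ := fun t => (F (A' / B' - η) t).toReal)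
      (h := fun t : ℝ => -t) (by simpa using hF'.hasDerivAt (A' / B' - η)) (hasDerivAt_neg 0)
    have hd := eventually_lt_of_hasDerivAt_neg hc (by
      rw [sub_mul, div_mul_cancel₀ _ hB0.ne', smul_eq_mul]
      linarith [mul_pos hη hB0])
    have htend : Tendsto (fun t : ℝ => -t) (𝓝[>] 0) (𝓝 0) := by
      have : Tendsto (fun t : ℝ => -t) (𝓝 0) (𝓝 0) := by
        simpa using (continuous_neg (G := ℝ)).tendsto 0
      exact this.mono_left nhdsWithin_le_nhds
    obtain ⟨t, ht1, ht2, ht3⟩ :=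
      (hd.and ((htend.eventually (hF'.ne_top (A' / B' - η))).and self_mem_nhdsWithin)).exists
    exact ⟨-t, neg_neg_of_pos ht3, hlt _ _ ht2 (by simpa using ht1)⟩

end Tilt

section Counting

variable {Δ : ℕ}

theorem singleton_mem_planted (hΔ : 3 ≤ Δ) {m i : ℕ} (hi : i ∈ planted Δ m) :
    nodeEquiv {i} ∈ planted Δ (m + 1) := by
  rw [planted, Set.mem_ofPred_eq, degs_nodeEquiv]
  refine ⟨by simp [hi.1], fun d hd => ?_⟩
  simp only [Multiset.card_singleton, Multiset.map_singleton, Multiset.sum_singleton,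
    Multiset.mem_cons] at hd
  rcases hd with rfl | hd
  · omega
  · exact hi.2 d hd

theorem pair_mem_planted (hΔ : 3 ≤ Δ) {l m i j : ℕ} (hi : i ∈ planted Δ l)
    (hj : j ∈ planted Δ m) : nodeEquiv {i, j} ∈ planted Δ (l + m + 1) := by
  rw [planted, Set.mem_ofPred_eq, degs_nodeEquiv]
  refine ⟨by simp [hi.1, hj.1], fun d hd => ?_⟩
  simp only [Multiset.insert_eq_cons, Multiset.card_cons, Multiset.card_singleton,
    Multiset.map_cons, Multiset.map_singleton, Multiset.sum_cons, Multiset.sum_singleton,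
    Multiset.mem_cons, Multiset.mem_add] at hd
  rcases hd with rfl | hd | hd
  · omega
  · exact hi.2 d hd
  · exact hj.2 d hd

theorem one_le_ncard_planted (hΔ : 3 ≤ Δ) (m : ℕ) : 1 ≤ (planted Δ (m + 1)).ncard := by
  rw [Nat.one_le_iff_ne_zero, ← Nat.pos_iff_ne_zero, Set.ncard_pos (finite_planted hΔ _)]
  induction m with
  | zero =>
    refine ⟨nodeEquiv 0, ?_⟩
    rw [planted, Set.mem_ofPred_eq, degs_nodeEquiv]
    simp
    omega
  | succ m ih =>
    obtain ⟨i, hi⟩ := ih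
    exact ⟨_, singleton_mem_planted hΔ hi⟩

theorem ncard_planted_mul_le (hΔ : 3 ≤ Δ) {l m : ℕ} (h : l ≠ m) :
    (planted Δ l).ncard * (planted Δ m).ncard ≤ (planted Δ (l + m + 1)).ncard := by
  rw [← Set.ncard_prod]
  refine Set.ncard_le_ncard_of_injOn (fun p => nodeEquiv {p.1, p.2})
    (fun p hp => pair_mem_planted hΔ hp.1 hp.2) ?_ (finite_planted hΔ _)
  rintro ⟨i, j⟩ ⟨hi, hj⟩ ⟨i', j'⟩ ⟨hi', hj'⟩ hij
  have h1 : ({i, j} : Multiset ℕ) = {i', j'} := nodeEquiv.injective hij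
  simp only [Multiset.insert_eq_cons, Multiset.cons_eq_cons, Multiset.singleton_inj] at h1
  rcases h1 with ⟨rfl, rfl⟩ | ⟨h2, cs, h3, h4⟩
  · rfl
  · have h5 : j = i' := by
      have : i' ∈ ({j} : Multiset ℕ) := by simp [h3]
      exact (Multiset.mem_singleton.1 this).symm
    exact absurd (hi'.1.symm.trans (h5 ▸ hj.1)) h

theorem pow_le_ncard_planted (hΔ : 3 ≤ Δ) {l s : ℕ} (hs : l < s) (q : ℕ) :
    (planted Δ l).ncard ^ q ≤ (planted Δ (q * (l + 1) + s)).ncard := by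
  induction q with
  | zero =>
    obtain ⟨s, rfl⟩ := Nat.exists_eq_succ_of_ne_zero (by omega : s ≠ 0)
    simpa using one_le_ncard_planted hΔ s
  | succ q ih =>
    have h1 : l ≠ q * (l + 1) + s := by
      have := Nat.zero_le (q * (l + 1))
      omega
    refine le_trans ?_ ((ncard_planted_mul_le hΔ h1).trans_eq (by congr 2; ring))
    rw [pow_succ']
    gcongr

theorem totalWeight_unifWeight_le_tsum (hΔ : 3 ≤ Δ) (x : ℝ≥0∞) :
    totalWeight (unifWeight Δ x) ≤ ∑' m : ℕ, ((planted Δ m).ncard : ℝ≥0∞) * x ^ m := by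
  have h1 : ∀ m : ℕ, ((planted Δ m).ncard : ℝ≥0∞) * x ^ m
      = ∑' n, (planted Δ m).indicator (fun _ => x ^ m) n := by
    intro m
    rw [← tsum_subtype, ENNReal.tsum_set_const, (finite_planted hΔ m).encard_eq_coe_toFinset_card,
      Set.ncard_eq_toFinset_card _ (finite_planted hΔ m)]
    simp
  simp_rw [h1]
  rw [ENNReal.tsum_comm]
  refine ENNReal.tsum_le_tsum fun n => ?_
  refine le_trans ?_ (ENNReal.le_tsum (degs n).card)
  by_cases h : n ∈ planted Δ (degs n).card
  · rw [Set.indicator_of_mem h, weight_unifWeight _ h]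
  · rw [weight_eq_zero (fun d hd => unifWeight_of_lt (Δ := Δ) x hd) h]
    exact zero_le

theorem exists_pow_le_ncard_planted (hΔ : 3 ≤ Δ) {b : ℝ} (hb : 0 < b)
    (hb' : b * (radius Δ).toReal < 1) : ∃ l, b ^ (l + 1) ≤ ((planted Δ l).ncard : ℝ) := by
  by_contra! h
  have hr := toReal_radius_pos hΔ
  obtain ⟨y, hy1, hy2⟩ := exists_between ((lt_div_iff₀' hb).2 hb')
  have hy0 : 0 < y := hr.trans hy1
  rw [lt_div_iff₀' hb] at hy2
  have h1 : radius Δ < ENNReal.ofReal y := by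
    rwa [← ENNReal.ofReal_toReal (radius_ne_top hΔ), ENNReal.ofReal_lt_ofReal_iff hy0]
  have h2 := totalWeight_unifWeight_le_tsum hΔ (ENNReal.ofReal y)
  rw [totalWeight_unifWeight_of_radius_lt h1, top_le_iff] at h2
  have h3 : Summable fun m : ℕ => b * (b * y) ^ m :=
    (summable_geometric_of_lt_one (by positivity) hy2).mul_left b
  refine h3.tsum_ofReal_ne_top (top_le_iff.1 (h2.ge.trans (ENNReal.tsum_le_tsum fun m => ?_)))
  rw [← ENNReal.ofReal_natCast, ← ENNReal.ofReal_pow hy0.le, ← ENNReal.ofReal_mul (by positivity)]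
  refine ENNReal.ofReal_le_ofReal ?_
  calc ((planted Δ m).ncard : ℝ) * y ^ m ≤ b ^ (m + 1) * y ^ m := by
        gcongr
        exact (h m).le
    _ = b * (b * y) ^ m := by ring

/-- The number of planted trees grows at least at the exponential rate given by the radius. -/
theorem exists_mul_pow_le_ncard_planted (hΔ : 3 ≤ Δ) {b : ℝ} (hb : 0 < b)
    (hb' : b * (radius Δ).toReal < 1) :
    ∃ c > 0, ∀ᶠ m in atTop, c * b ^ m ≤ ((planted Δ m).ncard : ℝ) := by
  rcases le_total b 1 with hb1 | hb1
  · refine ⟨1, one_pos, (eventually_ge_atTop 1).mono fun m hm => ?_⟩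
    obtain ⟨m, rfl⟩ := Nat.exists_eq_add_of_le' hm
    rw [one_mul]
    exact (pow_le_one₀ hb.le hb1).trans (by exact_mod_cast one_le_ncard_planted hΔ m)
  · obtain ⟨l, hl⟩ := exists_pow_le_ncard_planted hΔ hb hb'
    refine ⟨(b ^ (2 * l + 1))⁻¹, by positivity, (eventually_gt_atTop l).mono fun m hm => ?_⟩
    obtain ⟨q, s, hls, hs, rfl⟩ : ∃ q s, l < s ∧ s ≤ 2 * l + 1 ∧ m = q * (l + 1) + s := by
      refine ⟨(m - (l + 1)) / (l + 1), (m - (l + 1)) % (l + 1) + (l + 1), by omega, ?_, ?_⟩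
      · have := Nat.mod_lt (m - (l + 1)) (Nat.succ_pos l)
        rw [Nat.succ_eq_add_one] at this
        omega
      · have := Nat.div_add_mod' (m - (l + 1)) (l + 1)
        omega
    have h1 := pow_le_ncard_planted hΔ hls q
    calc (b ^ (2 * l + 1))⁻¹ * b ^ (q * (l + 1) + s)
          ≤ (b ^ s)⁻¹ * b ^ (q * (l + 1) + s) := by gcongr
      _ = (b ^ (l + 1)) ^ q := by
        rw [pow_add, ← pow_mul, mul_comm (l + 1), mul_left_comm, inv_mul_cancel₀ (by positivity),
          mul_one]
      _ ≤ ((planted Δ l).ncard : ℝ) ^ q := by gcongr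
      _ ≤ _ := by exact_mod_cast h1

/-- Large deviations: planted trees for which `stat f` is far from its typical value are
exponentially rare at the critical exponential scale. -/
theorem exists_tail_le (hΔ : 3 ≤ Δ) (f : ℕ → ℝ) : ∃ d C : ℝ, ∀ η : ℝ, 0 < η → ∃ c > 0, ∀ m : ℕ,
    ({n ∈ planted Δ m | η * m < |stat f n - d * m|}.ncard : ℝ) *
      ((radius Δ).toReal ^ m * Real.exp (c * m)) ≤ C := by
  set r := (radius Δ).toReal with hr
  have hr0 : 0 < r := toReal_radius_pos hΔ
  obtain ⟨d, hd⟩ := exists_slope hΔ f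
  set τ := totalWeight (unifWeight Δ (radius Δ))
  have hτ : τ ≠ ⊤ := totalWeight_unifWeight_radius_ne_top hΔ
  refine ⟨d, (τ + τ).toReal, fun η hη => ?_⟩
  obtain ⟨⟨t, ht, h1⟩, s, hs, h2⟩ := hd (η / 2) (by positivity)
  refine ⟨min t (-s) * (η / 2), mul_pos (lt_min ht (by linarith)) (by positivity), fun m => ?_⟩
  set c := min t (-s) * (η / 2)
  set S := {n ∈ planted Δ m | η * m < |stat f n - d * m|}
  have hS : S.Finite := (finite_planted hΔ m).subset fun n hn => hn.1
  have hm : (0 : ℝ) ≤ m := Nat.cast_nonneg m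
  have hct : c * m ≤ t * (η / 2 * m) := by
    rw [mul_assoc]
    exact mul_le_mul_of_nonneg_right (min_le_left _ _) (by positivity)
  have hcs : c * m ≤ -s * (η / 2 * m) := by
    rw [mul_assoc]
    exact mul_le_mul_of_nonneg_right (min_le_right _ _) (by positivity)
  have key : ∀ n ∈ S, ENNReal.ofReal (r ^ m * Real.exp (c * m)) ≤
      weight (tiltWeight Δ f (d + η / 2) t) n + weight (tiltWeight Δ f (d - η / 2) s) n := by
    rintro n ⟨hn, hn'⟩
    rw [weight_tiltWeight _ _ hn, weight_tiltWeight _ _ hn]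
    rcases lt_abs.1 hn' with h | h
    · refine le_trans (ENNReal.ofReal_le_ofReal ?_) le_self_add
      refine mul_le_mul_of_nonneg_left (Real.exp_le_exp.2 ?_) (by positivity)
      refine hct.trans (mul_le_mul_of_nonneg_left ?_ ht.le)
      linarith
    · refine le_trans (ENNReal.ofReal_le_ofReal ?_) le_add_self
      refine mul_le_mul_of_nonneg_left (Real.exp_le_exp.2 ?_) (by positivity)
      refine hcs.trans ?_
      rw [neg_mul, ← mul_neg]
      refine mul_le_mul_of_nonpos_left ?_ hs.le
      linarith
  have h3 : (S.ncard : ℝ≥0∞) * ENNReal.ofReal (r ^ m * Real.exp (c * m)) ≤ τ + τ := by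
    calc (S.ncard : ℝ≥0∞) * ENNReal.ofReal (r ^ m * Real.exp (c * m))
        = ∑ n ∈ hS.toFinset, ENNReal.ofReal (r ^ m * Real.exp (c * m)) := by
          rw [Finset.sum_const, nsmul_eq_mul, Set.ncard_eq_toFinset_card _ hS]
      _ ≤ ∑ n ∈ hS.toFinset, (weight (tiltWeight Δ f (d + η / 2) t) n +
            weight (tiltWeight Δ f (d - η / 2) s) n) :=
          Finset.sum_le_sum fun n hn => key n (by simpa using hn)
      _ ≤ ∑' n, (weight (tiltWeight Δ f (d + η / 2) t) n +
            weight (tiltWeight Δ f (d - η / 2) s) n) := ENNReal.sum_le_tsum _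
      _ = totalWeight (tiltWeight Δ f (d + η / 2) t) +
            totalWeight (tiltWeight Δ f (d - η / 2) s) := ENNReal.tsum_add
      _ ≤ τ + τ := add_le_add h1 h2
  have h4 := ENNReal.toReal_mono (ENNReal.add_ne_top.2 ⟨hτ, hτ⟩) h3
  rwa [ENNReal.toReal_mul, ENNReal.toReal_natCast, ENNReal.toReal_ofReal (by positivity)] at h4

/-- The proportion of planted trees for which `stat f` is far from its typical value decays
faster than the inverse of the number of vertices. -/
theorem exists_tendsto_tail (hΔ : 3 ≤ Δ) (f : ℕ → ℝ) : ∃ d : ℝ, ∀ η : ℝ, 0 < η →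
    Tendsto (fun m : ℕ => ({n ∈ planted Δ m | η * m < |stat f n - d * m|}.ncard : ℝ) * (m + 1) /
      (planted Δ m).ncard) atTop (𝓝 0) := by
  obtain ⟨d, C, h⟩ := exists_tail_le hΔ f
  refine ⟨d, fun η hη => ?_⟩
  obtain ⟨c, hc, htail⟩ := h η hη
  set r := (radius Δ).toReal with hr
  have hr0 : 0 < r := toReal_radius_pos hΔ
  have hb : r⁻¹ * Real.exp (-(c / 2)) * r < 1 := by
    rw [mul_right_comm, inv_mul_cancel₀ hr0.ne', one_mul, Real.exp_lt_one_iff]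
    linarith
  obtain ⟨c₀, hc₀, hlow⟩ := exists_mul_pow_le_ncard_planted hΔ (by positivity) hb
  have hlim : Tendsto (fun m : ℕ => C / c₀ * ((m + 1) * Real.exp (-(c / 2)) ^ m)) atTop (𝓝 0) := by
    have he : |Real.exp (-(c / 2))| < 1 := by
      rw [Real.abs_exp, Real.exp_lt_one_iff]
      linarith
    have h1 := (tendsto_self_mul_const_pow_of_abs_lt_one he).add
      (tendsto_pow_atTop_nhds_zero_of_abs_lt_one he)
    have h2 := h1.const_mul (C / c₀)
    simp only [add_zero, mul_zero] at h2
    exact h2.congr fun m => by ring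
  refine squeeze_zero' (Eventually.of_forall fun m => by positivity) ?_ hlim
  filter_upwards [hlow] with m hm
  have h1 := htail m
  set A : ℝ := ({n ∈ planted Δ m | η * m < |stat f n - d * m|}.ncard : ℝ)
  have hA : A ≤ C * (r⁻¹ * Real.exp (-c)) ^ m := by
    rw [← le_div_iff₀ (by positivity)] at h1
    refine h1.trans_eq ?_
    rw [mul_pow, ← Real.exp_nat_mul, div_eq_mul_inv, mul_inv, inv_pow, ← Real.exp_neg]
    ring_nf
  calc A * (m + 1) / (planted Δ m).ncard
      ≤ (C * (r⁻¹ * Real.exp (-c)) ^ m) * (m + 1) / (c₀ * (r⁻¹ * Real.exp (-(c / 2))) ^ m) := by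
        gcongr
        exact mul_nonneg ((by positivity : (0 : ℝ) ≤ A).trans hA) (by positivity)
    _ = C / c₀ * ((m + 1) * Real.exp (-(c / 2)) ^ m) := by
      have : Real.exp (-c) = Real.exp (-(c / 2)) * Real.exp (-(c / 2)) := by
        rw [← Real.exp_add]
        ring_nf
      rw [this, mul_pow, mul_pow, mul_pow]
      field_simp

end Counting

/-- The degree of a vertex of a graph. -/
noncomputable def gdeg {V : Type} (G : SimpleGraph V) (v : V) : ℕ := Nat.card {u : V // G.Adj v u}

theorem gdeg_iso {V W : Type} {G : SimpleGraph V} {H : SimpleGraph W} (φ : G ≃g H) (v : V) :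
    gdeg H (φ v) = gdeg G v :=
  (Nat.card_congr (φ.toEquiv.subtypeEquiv fun _ => φ.map_adj_iff.symm)).symm

/-- A finite graph with a distinguished vertex. -/
structure Rooted where
  /-- The vertices. -/
  V : Type
  [fin : Fintype V]
  /-- The underlying graph. -/
  G : SimpleGraph V
  /-- The distinguished vertex. -/
  root : V

namespace Rooted

attribute [instance] Rooted.fin

/-- Isomorphism of rooted graphs. -/
def Iso (X Y : Rooted) : Prop := ∃ φ : X.G ≃g Y.G, φ X.root = Y.root

theorem Iso.refl (X : Rooted) : Iso X X := ⟨SimpleGraph.Iso.refl, rfl⟩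

theorem Iso.symm {X Y : Rooted} : Iso X Y → Iso Y X := fun ⟨φ, h⟩ =>
  ⟨φ.symm, by rw [← h]; exact φ.symm_apply_apply _⟩

theorem Iso.trans {X Y Z : Rooted} : Iso X Y → Iso Y Z → Iso X Z := fun ⟨φ, h⟩ ⟨ψ, h'⟩ =>
  ⟨φ.trans ψ, by rw [← h', ← h]; rfl⟩

/-- The graph with a single vertex. -/
def point : Rooted := ⟨Unit, ⊥, ()⟩

/-- The disjoint union of two rooted graphs with an edge added between the roots; the root of the
first graph becomes the new root. -/
def join (X Y : Rooted) : Rooted :=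
  ⟨X.V ⊕ Y.V, X.G.sum Y.G ⊔ SimpleGraph.edge (.inl X.root) (.inr Y.root), .inl X.root⟩

section Adj

variable (X Y : Rooted)

@[simp] theorem join_adj_inl_inl (a b : X.V) :
    (X.join Y).G.Adj (.inl a) (.inl b) ↔ X.G.Adj a b := by
  simp [join, SimpleGraph.edge_adj]

@[simp] theorem join_adj_inr_inr (a b : Y.V) :
    (X.join Y).G.Adj (.inr a) (.inr b) ↔ Y.G.Adj a b := by
  simp [join, SimpleGraph.edge_adj]

@[simp] theorem join_adj_inl_inr (a : X.V) (b : Y.V) :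
    (X.join Y).G.Adj (.inl a) (.inr b) ↔ a = X.root ∧ b = Y.root := by
  simp [join, SimpleGraph.edge_adj]

@[simp] theorem join_adj_inr_inl (a : X.V) (b : Y.V) :
    (X.join Y).G.Adj (.inr b) (.inl a) ↔ a = X.root ∧ b = Y.root := by
  simp [join, SimpleGraph.edge_adj, and_comm]

end Adj

theorem Iso.join {X X' Y Y' : Rooted} : Iso X X' → Iso Y Y' → Iso (X.join Y) (X'.join Y') := by
  rintro ⟨φ, h⟩ ⟨ψ, h'⟩
  refine ⟨⟨Equiv.sumCongr φ.toEquiv ψ.toEquiv, ?_⟩, congrArg Sum.inl h⟩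
  have hr : ∀ a, φ a = X'.root ↔ a = X.root := fun a => by rw [← h, φ.injective.eq_iff]
  have hr' : ∀ a, ψ a = Y'.root ↔ a = Y.root := fun a => by rw [← h', ψ.injective.eq_iff]
  rintro (a | a) (b | b)
  · exact (join_adj_inl_inl ..).trans (φ.map_adj_iff.trans (join_adj_inl_inl ..).symm)
  · exact (join_adj_inl_inr ..).trans ((and_congr (hr _) (hr' _)).trans (join_adj_inl_inr ..).symm)
  · exact (join_adj_inr_inl ..).trans ((and_congr (hr _) (hr' _)).trans (join_adj_inr_inl ..).symm)
  · exact (join_adj_inr_inr ..).trans (ψ.map_adj_iff.trans (join_adj_inr_inr ..).symm)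

theorem join_right_comm (X Y Z : Rooted) : Iso ((X.join Y).join Z) ((X.join Z).join Y) := by
  let e : (X.V ⊕ Y.V) ⊕ Z.V ≃ (X.V ⊕ Z.V) ⊕ Y.V :=
    { toFun := Sum.elim (Sum.elim (fun x => .inl (.inl x)) .inr) (fun z => .inl (.inr z))
      invFun := Sum.elim (Sum.elim (fun x => .inl (.inl x)) .inr) (fun z => .inl (.inr z))
      left_inv := by rintro ((a | a) | a) <;> rfl
      right_inv := by rintro ((a | a) | a) <;> rfl }
  have ll := join_adj_inl_inl
  have lr := join_adj_inl_inr
  have rl := join_adj_inr_inl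
  have rr := join_adj_inr_inr
  have hi : ∀ {V W : Type} (a b : V), (Sum.inl a : V ⊕ W) = Sum.inl b ↔ a = b := fun a b =>
    Sum.inl_injective.eq_iff
  have hf : ∀ {V W : Type} (a : V) (b : W) (p : Prop),
      (Sum.inr b : V ⊕ W) = Sum.inl a ∧ p ↔ False :=
    fun a b p => by simp
  refine ⟨⟨e, ?_⟩, rfl⟩
  rintro ((a | a) | a) ((b | b) | b)
  · exact ((ll (X.join Z) Y _ _).trans (ll X Z _ _)).trans
      ((ll (X.join Y) Z _ _).trans (ll X Y _ _)).symm
  · exact ((lr (X.join Z) Y _ _).trans (and_congr_left' (hi _ _))).trans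
      ((ll (X.join Y) Z _ _).trans (lr X Y _ _)).symm
  · exact ((ll (X.join Z) Y _ _).trans (lr X Z _ _)).trans
      ((lr (X.join Y) Z _ _).trans (and_congr_left' (hi _ _))).symm
  · exact ((rl (X.join Z) Y _ _).trans (and_congr_left' (hi _ _))).trans
      ((ll (X.join Y) Z _ _).trans (rl X Y _ _)).symm
  · exact (rr (X.join Z) Y _ _).trans ((ll (X.join Y) Z _ _).trans (rr X Y _ _)).symm
  · exact ((rl (X.join Z) Y _ _).trans (hf _ _ _)).trans
      ((lr (X.join Y) Z _ _).trans (hf _ _ _)).symm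
  · exact ((ll (X.join Z) Y _ _).trans (rl X Z _ _)).trans
      ((rl (X.join Y) Z _ _).trans (and_congr_left' (hi _ _))).symm
  · exact ((lr (X.join Z) Y _ _).trans (hf _ _ _)).trans
      ((rl (X.join Y) Z _ _).trans (hf _ _ _)).symm
  · exact ((ll (X.join Z) Y _ _).trans (rr X Z _ _)).trans (rr (X.join Y) Z _ _).symm

theorem gdeg_join_inl (X Y : Rooted) (a : X.V) [Decidable (a = X.root)] :
    gdeg (X.join Y).G (.inl a) = gdeg X.G a + if a = X.root then 1 else 0 := by
  have h := Nat.card_congr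
    (Equiv.subtypeSum (α := X.V) (β := Y.V) (p := (X.join Y).G.Adj (.inl a)))
  rw [Nat.card_sum] at h
  refine h.trans ?_
  simp only [join_adj_inl_inl, join_adj_inl_inr]
  congr 1
  split_ifs with ha <;> simp [ha]

theorem gdeg_join_inr (X Y : Rooted) (b : Y.V) [Decidable (b = Y.root)] :
    gdeg (X.join Y).G (.inr b) = gdeg Y.G b + if b = Y.root then 1 else 0 := by
  have h := Nat.card_congr
    (Equiv.subtypeSum (α := X.V) (β := Y.V) (p := (X.join Y).G.Adj (.inr b)))
  rw [Nat.card_sum] at h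
  refine h.trans ?_
  simp only [join_adj_inr_inl, join_adj_inr_inr]
  rw [add_comm]
  congr 1
  split_ifs with ha <;> simp [ha]

end Rooted

/-- Expressions building rooted trees by successively attaching branches. -/
inductive TreeExpr
  | point : TreeExpr
  | join : TreeExpr → TreeExpr → TreeExpr

namespace TreeExpr

/-- The rooted tree described by an expression. -/
def tree : TreeExpr → Rooted
  | point => Rooted.point
  | join s t => s.tree.join t.tree

/-- The code of the rooted tree described by an expression. -/
noncomputable def code : TreeExpr → ℕ
  | point => nodeEquiv 0
  | join s t => nodeEquiv (t.code ::ₘ children s.code)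

theorem children_code_join (s t : TreeExpr) :
    children (join s t).code = t.code ::ₘ children s.code := by
  rw [code, children_nodeEquiv]

theorem exists_code_eq (n : ℕ) : ∃ s : TreeExpr, s.code = n := by
  induction n using Nat.strong_induction_on with
  | _ n ih =>
    obtain ⟨M, rfl⟩ := nodeEquiv.surjective n
    replace ih : ∀ k ∈ M, ∃ s : TreeExpr, s.code = k := fun k hk => ih k (lt_nodeEquiv_of_mem hk)
    induction M using Multiset.induction_on with
    | empty => exact ⟨point, rfl⟩
    | cons a M ih' =>
      obtain ⟨s, hs⟩ := ih' fun k hk => ih k (Multiset.mem_cons_of_mem hk)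
      obtain ⟨t, ht⟩ := ih a (Multiset.mem_cons_self _ _)
      exact ⟨join s t, by rw [code, ht, hs, children_nodeEquiv]⟩

theorem exists_iso_join {s : TreeExpr} {k : ℕ} (hk : k ∈ children s.code) :
    ∃ s' t : TreeExpr, t.code = k ∧ children s.code = k ::ₘ children s'.code ∧
      s.tree.Iso (s'.tree.join t.tree) := by
  induction s with
  | point => simp [code] at hk
  | join s t ih _ =>
    rw [children_code_join, Multiset.mem_cons] at hk
    rcases hk with rfl | hk
    · exact ⟨s, t, rfl, children_code_join _ _, Rooted.Iso.refl _⟩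
    · obtain ⟨s', t', rfl, h2, h3⟩ := ih hk
      refine ⟨join s' t, t', rfl, ?_, ?_⟩
      · rw [children_code_join, children_code_join, h2, Multiset.cons_swap]
      · exact (h3.join (Rooted.Iso.refl _)).trans (Rooted.join_right_comm _ _ _)

/-- Rooted trees with the same code are isomorphic. -/
theorem iso_of_code_eq {s t : TreeExpr} (h : s.code = t.code) : s.tree.Iso t.tree := by
  induction s generalizing t with
  | point =>
    cases t with
    | point => exact Rooted.Iso.refl _
    | join t t' =>
      have := children_code_join t t'
      rw [← h] at this
      simp [code] at this
  | join s s' ih ih' =>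
    have h1 := children_code_join s s'
    rw [h] at h1
    obtain ⟨u, u', hu', h2, h3⟩ := exists_iso_join (s := t) (k := s'.code) (by simp [h1])
    rw [h1, Multiset.cons_inj_right] at h2
    exact ((ih (nodeEquiv.symm.injective h2)).join (ih' hu'.symm)).trans h3.symm

theorem card_children_code (s : TreeExpr) :
    (children s.code).card = gdeg s.tree.G s.tree.root := by
  classical
  induction s with
  | point => simp [code, gdeg, tree, Rooted.point]
  | join s t ih _ =>
    rw [children_code_join, Multiset.card_cons, ih]
    refine Eq.symm ((Rooted.gdeg_join_inl _ _ _).trans ?_)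
    rw [if_pos rfl]

theorem sum_eq_add_sum_ite {V M : Type} [Fintype V] [AddCommMonoid M] (g : V → M) (v : V)
    [DecidableEq V] : ∑ x, g x = g v + ∑ x, if x = v then 0 else g x := by
  rw [← Finset.add_sum_erase _ _ (Finset.mem_univ v)]
  congr 1
  rw [← Finset.add_sum_erase _ (fun x => if x = v then 0 else g x) (Finset.mem_univ v), if_pos rfl,
    zero_add]
  exact Finset.sum_congr rfl fun x hx => (if_neg (Finset.ne_of_mem_erase hx)).symm

open Classical in
/-- The degrees of the vertices of a rooted tree other than the root are given by its code. -/
theorem sum_gdeg (s : TreeExpr) {M : Type} [AddCommMonoid M] (g : ℕ → M) :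
    (∑ x, if x = s.tree.root then 0 else g (gdeg s.tree.G x))
      = (((children s.code).map degs).sum.map g).sum := by
  induction s with
  | point =>
    simp only [code]
    rw [children_nodeEquiv, Multiset.map_zero, Multiset.sum_zero, Multiset.map_zero,
      Multiset.sum_zero]
    exact Finset.sum_eq_zero fun x _ => if_pos rfl
  | join s t ih ih' =>
    rw [children_code_join, Multiset.map_cons, Multiset.sum_cons, Multiset.map_add,
      Multiset.sum_add, degs_eq, Multiset.map_cons, Multiset.sum_cons, ← ih, ← ih',
      card_children_code]
    refine (Fintype.sum_sum_type _).trans ?_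
    rw [add_comm]
    congr 1
    · refine (sum_eq_add_sum_ite _ t.tree.root).trans ?_
      refine congrArg₂ (· + ·) ((if_neg Sum.inr_ne_inl).trans (congrArg g ?_))
        (Finset.sum_congr rfl fun x _ => ?_)
      · exact (Rooted.gdeg_join_inr _ _ _).trans (by rw [if_pos rfl])
      · split_ifs with h h'
        · rfl
        · exact absurd h' Sum.inr_ne_inl
        · exact congrArg g ((Rooted.gdeg_join_inr _ _ _).trans (by rw [if_neg h, add_zero]))
    · refine Finset.sum_congr rfl fun x _ => ?_
      by_cases h : x = s.tree.root
      · rw [if_pos h]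
        exact if_pos (congrArg Sum.inl h)
      · rw [if_neg h]
        refine (if_neg fun h' => h (Sum.inl_injective h')).trans (congrArg g ?_)
        exact (Rooted.gdeg_join_inl _ _ _).trans (by rw [if_neg h, add_zero])

end TreeExpr

open Classical in
/-- The code of the part of a graph visible from the vertex `v` when the vertices in `S` are
removed, explored up to depth `k`. -/
noncomputable def visibleCode {V : Type} [Fintype V] (G : SimpleGraph V) : ℕ → Set V → V → ℕ
  | 0, _, _ => 0
  | k + 1, S, v =>
    nodeEquiv (∑ u, if G.Adj v u ∧ u ∉ S then {visibleCode G k (insert v S) u} else 0)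

open Classical in
theorem visibleCode_succ {V : Type} [Fintype V] (G : SimpleGraph V) (k : ℕ) (S : Set V) (v : V) :
    visibleCode G (k + 1) S v =
      nodeEquiv (∑ u, if G.Adj v u ∧ u ∉ S then {visibleCode G k (insert v S) u} else 0) := rfl

open Classical in
theorem visibleCode_iso {V W : Type} [Fintype V] [Fintype W] {G : SimpleGraph V}
    {H : SimpleGraph W} (φ : G ≃g H) (k : ℕ) (S : Set W) (v : V) :
    visibleCode G k (φ ⁻¹' S) v = visibleCode H k S (φ v) := by
  induction k generalizing S v with
  | zero => rfl
  | succ k ih =>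
    rw [visibleCode, visibleCode, ← Equiv.sum_comp φ.toEquiv]
    refine congrArg nodeEquiv (Finset.sum_congr rfl fun u _ => ?_)
    have h : insert v (φ ⁻¹' S) = φ ⁻¹' (insert (φ v) S) := by
      ext x
      simp [φ.injective.eq_iff]
    rw [h, ih]
    refine if_congr ?_ rfl rfl
    exact and_congr φ.map_adj_iff.symm Iff.rfl

namespace Rooted

open Classical in
theorem visibleCode_join_inr (X Y : Rooted) (k : ℕ) (S : Set (X.V ⊕ Y.V))
    (hS : Sum.inl X.root ∈ S) (y : Y.V) :
    visibleCode (X.join Y).G k S (Sum.inr y) = visibleCode Y.G k (Sum.inr ⁻¹' S) y := by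
  induction k generalizing S y with
  | zero => rfl
  | succ k ih =>
    refine (visibleCode_succ _ _ _ _).trans (Eq.trans ?_ (visibleCode_succ _ _ _ _).symm)
    refine congrArg nodeEquiv ((Fintype.sum_sum_type _).trans ?_)
    rw [Finset.sum_eq_zero, zero_add]
    · refine Finset.sum_congr rfl fun u _ => ?_
      refine if_congr (and_congr (join_adj_inr_inr _ _ _ _) Iff.rfl) ?_ rfl
      refine congrArg _ ((ih _ (Set.mem_insert_of_mem _ hS) _).trans ?_)
      congr 1
      ext x
      simp
    · refine fun u _ => if_neg fun h => h.2 ?_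
      rw [((join_adj_inr_inl _ _ _ _).1 h.1).1]
      exact hS

open Classical in
theorem visibleCode_join_inl (X Y : Rooted) (k : ℕ) (S : Set (X.V ⊕ Y.V))
    (hS : Sum.inl X.root ∈ S) (x : X.V) (hx : x ≠ X.root) :
    visibleCode (X.join Y).G k S (Sum.inl x) = visibleCode X.G k (Sum.inl ⁻¹' S) x := by
  induction k generalizing S x with
  | zero => rfl
  | succ k ih =>
    refine (visibleCode_succ _ _ _ _).trans (Eq.trans ?_ (visibleCode_succ _ _ _ _).symm)
    refine congrArg nodeEquiv ((Fintype.sum_sum_type _).trans ?_)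
    rw [add_comm, Finset.sum_eq_zero, zero_add]
    · refine Finset.sum_congr rfl fun u _ => ?_
      refine ite_congr (propext (and_congr (join_adj_inl_inl _ _ _ _) Iff.rfl)) (fun h => ?_)
        fun _ => rfl
      refine congrArg _ ((ih _ (Set.mem_insert_of_mem _ hS) u fun hu => h.2 (hu ▸ hS)).trans ?_)
      congr 1
      ext x
      simp
    · exact fun u _ => if_neg fun h => hx ((join_adj_inl_inr _ _ _ _).1 h.1).1

open Classical in
theorem visibleCode_join_root (X Y : Rooted) (k : ℕ) :
    visibleCode (X.join Y).G (k + 1) ∅ (X.join Y).root = nodeEquiv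
      (visibleCode Y.G k ∅ Y.root ::ₘ children (visibleCode X.G (k + 1) ∅ X.root)) := by
  have hX : (insert X.root ∅ : Set X.V) =
      Sum.inl ⁻¹' (insert (Sum.inl X.root) ∅ : Set (_ ⊕ Y.V)) := by
    ext x
    simp
  have hY : (∅ : Set Y.V) = Sum.inr ⁻¹' (insert (Sum.inl X.root) ∅ : Set (X.V ⊕ Y.V)) := by
    ext x
    change False ↔ _
    simp
  rw [visibleCode_succ X.G, children_nodeEquiv, ← Multiset.singleton_add, add_comm {_}]
  refine (visibleCode_succ _ _ _ _).trans (congrArg nodeEquiv ?_)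
  refine (Fintype.sum_sum_type _).trans (congrArg₂ (· + ·) ?_ ?_)
  · refine Finset.sum_congr rfl fun u _ => ?_
    by_cases h : X.G.Adj X.root u
    · refine (if_pos ⟨(join_adj_inl_inl _ _ _ _).2 h, Set.notMem_empty _⟩).trans
        (Eq.trans ?_ (if_pos ⟨h, Set.notMem_empty _⟩).symm)
      rw [hX]
      exact congrArg _ (visibleCode_join_inl X Y k _ (Set.mem_insert _ _) u h.ne')
    · exact (if_neg fun h' => h ((join_adj_inl_inl _ _ _ _).1 h'.1)).trans
        (if_neg fun h' => h h'.1).symm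
  · rw [Finset.sum_eq_single Y.root]
    · refine (if_pos ⟨(join_adj_inl_inr _ _ _ _).2 ⟨rfl, rfl⟩, Set.notMem_empty _⟩).trans ?_
      rw [hY]
      exact congrArg _ (visibleCode_join_inr X Y k _ (Set.mem_insert _ _) _)
    · exact fun u _ hu => if_neg fun h => hu ((join_adj_inl_inr _ _ _ _).1 h.1).2
    · exact fun h => absurd (Finset.mem_univ _) h

end Rooted

namespace TreeExpr

theorem eventually_visibleCode_eq (s : TreeExpr) :
    ∀ᶠ k in atTop, visibleCode s.tree.G k ∅ s.tree.root = s.code := by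
  induction s with
  | point =>
    filter_upwards [eventually_ge_atTop 1] with k hk
    obtain ⟨k, rfl⟩ := Nat.exists_eq_add_of_le' hk
    rw [visibleCode]
    refine congrArg nodeEquiv (Finset.sum_eq_zero fun u _ => if_neg fun h => h.1)
  | join s t ih ih' =>
    obtain ⟨K, hK⟩ := eventually_atTop.1 ih
    obtain ⟨K', hK'⟩ := eventually_atTop.1 ih'
    refine eventually_atTop.2 ⟨max K K' + 1, fun k hk => ?_⟩
    obtain ⟨k, rfl⟩ := Nat.exists_eq_add_of_le' (le_of_add_le_right hk)
    refine (Rooted.visibleCode_join_root s.tree t.tree k).trans ?_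
    rw [hK _ (by omega), hK' _ (by omega)]
    rfl

/-- Isomorphic rooted trees have the same code. -/
theorem code_eq_of_iso {s t : TreeExpr} (h : s.tree.Iso t.tree) : s.code = t.code := by
  obtain ⟨φ, hφ⟩ := h
  obtain ⟨k, h1, h2⟩ := (s.eventually_visibleCode_eq.and t.eventually_visibleCode_eq).exists
  rw [← h1, ← h2, ← hφ, ← visibleCode_iso, Set.preimage_empty]

theorem connected_tree (s : TreeExpr) : s.tree.G.Connected := by
  induction s with
  | point =>
    have : Subsingleton (point.tree.V) := inferInstanceAs (Subsingleton Unit)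
    have : Nonempty (point.tree.V) := ⟨()⟩
    exact ⟨SimpleGraph.Preconnected.of_subsingleton⟩
  | join s t ih ih' => exact ih.sum_sup_edge ih'

theorem sum_gdeg_add_two (s : TreeExpr) :
    ∑ x, gdeg s.tree.G x + 2 = 2 * Nat.card s.tree.V := by
  classical
  induction s with
  | point =>
    rw [show Nat.card point.tree.V = 1 from Nat.card_unique (α := Unit), Finset.sum_eq_zero]
    intro x _
    exact Nat.card_eq_zero.2 (.inl ⟨fun h => h.2⟩)
  | join s t ih ih' =>
    have h : Nat.card (s.join t).tree.V = Nat.card s.tree.V + Nat.card t.tree.V := Nat.card_sum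
    have h2 : ∀ X : Rooted, (∑ a : X.V, if a = X.root then 1 else 0) = 1 := fun X => by simp
    have h1 : ∑ x, gdeg (s.join t).tree.G x
        = ∑ x, gdeg s.tree.G x + 1 + (∑ x, gdeg t.tree.G x + 1) := by
      refine (Fintype.sum_sum_type _).trans (congrArg₂ (· + ·) ?_ ?_)
      · rw [← h2 s.tree, ← Finset.sum_add_distrib]
        exact Finset.sum_congr rfl fun x _ => Rooted.gdeg_join_inl _ _ _
      · rw [← h2 t.tree, ← Finset.sum_add_distrib]
        exact Finset.sum_congr rfl fun x _ => Rooted.gdeg_join_inr _ _ _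
    rw [h, h1]
    omega

theorem isTree_tree (s : TreeExpr) : s.tree.G.IsTree := by
  classical
  rw [SimpleGraph.isTree_iff_connected_and_card]
  refine ⟨s.connected_tree, ?_⟩
  have h := s.tree.G.sum_degrees_eq_twice_card_edges
  have h2 := s.sum_gdeg_add_two
  have h3 : ∑ x, gdeg s.tree.G x = ∑ x, s.tree.G.degree x := by
    refine Finset.sum_congr rfl fun x _ => ?_
    rw [← SimpleGraph.card_neighborSet_eq_degree, ← Nat.card_eq_fintype_card]
    rfl
  rw [Nat.card_eq_fintype_card (α := s.tree.G.edgeSet), ← SimpleGraph.edgeFinset_card]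
  omega

end TreeExpr

theorem reachable_deleteEdges_or {V : Type} {G : SimpleGraph V} (hG : G.Preconnected) (v w x : V) :
    (G.deleteEdges {s(v, w)}).Reachable x v ∨ (G.deleteEdges {s(v, w)}).Reachable x w := by
  obtain ⟨p⟩ := hG x v
  induction p with
  | nil => exact .inl (SimpleGraph.Reachable.refl _)
  | @cons a b c h p ih =>
    by_cases hab : s(a, b) = s(c, w)
    · rcases Sym2.eq_iff.1 hab with ⟨rfl, _⟩ | ⟨rfl, _⟩
      · exact .inl (SimpleGraph.Reachable.refl _)
      · exact .inr (SimpleGraph.Reachable.refl _)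
    · have h' : (G.deleteEdges {s(c, w)}).Adj a b := by
        rw [SimpleGraph.deleteEdges_adj]
        exact ⟨h, hab⟩
      exact ih.imp h'.reachable.trans h'.reachable.trans

/-- A tree is obtained by joining the two components that remain when an edge is deleted. -/
theorem iso_join_connectedComponent {V : Type} [Fintype V] {G : SimpleGraph V} (hG : G.IsTree)
    {v w : V} (h : G.Adj v w) (C D : (G.deleteEdges {s(v, w)}).ConnectedComponent) (hv : v ∈ C)
    (hw : w ∈ D) [Fintype C] [Fintype D] :
    (Rooted.mk V G v).Iso
      ((Rooted.mk C C.toSimpleGraph ⟨v, hv⟩).join (Rooted.mk D D.toSimpleGraph ⟨w, hw⟩)) := by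
  have hb : ¬ (G.deleteEdges {s(v, w)}).Reachable v w :=
    SimpleGraph.isBridge_iff.1 (SimpleGraph.isAcyclic_iff_forall_adj_isBridge.1 hG.isAcyclic h)
  have hC : ∀ x, x ∈ C ↔ (G.deleteEdges {s(v, w)}).Reachable x v := fun x => by
    rw [← SimpleGraph.ConnectedComponent.eq]
    rw [show (G.deleteEdges {s(v, w)}).connectedComponentMk v = C from hv]
    rfl
  have hD : ∀ x, x ∈ D ↔ (G.deleteEdges {s(v, w)}).Reachable x w := fun x => by
    rw [← SimpleGraph.ConnectedComponent.eq]
    rw [show (G.deleteEdges {s(v, w)}).connectedComponentMk w = D from hw]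
    rfl
  have hdisj : ∀ x, x ∈ C → x ∉ D := fun x hx hx' =>
    hb (((hC x).1 hx).symm.trans ((hD x).1 hx'))
  have hadj : ∀ a b, (G.deleteEdges {s(v, w)}).Adj a b ↔ G.Adj a b ∧ s(a, b) ≠ s(v, w) :=
    fun a b => by simp [SimpleGraph.deleteEdges_adj]
  have hmix : ∀ a ∈ C, ∀ b ∈ D, G.Adj a b ↔ a = v ∧ b = w := by
    refine fun a ha b hb' => ⟨fun hab => ?_, fun hab => hab.1 ▸ hab.2 ▸ h⟩
    by_contra hne
    have : (G.deleteEdges {s(v, w)}).Adj a b := by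
      refine (hadj a b).2 ⟨hab, fun hs => ?_⟩
      rcases Sym2.eq_iff.1 hs with h1 | h1
      · exact hne h1
      · exact hdisj v hv (h1.2 ▸ hb')
    exact hb (((hC a).1 ha).symm.trans (this.reachable.trans ((hD b).1 hb')))
  have hCC : ∀ a ∈ C, ∀ b ∈ C, (G.deleteEdges {s(v, w)}).Adj a b ↔ G.Adj a b := by
    refine fun a ha b hb' => (hadj a b).trans (and_iff_left fun hs => ?_)
    rcases Sym2.eq_iff.1 hs with h1 | h1
    · exact hdisj w (h1.2 ▸ hb') hw
    · exact hdisj w (h1.1 ▸ ha) hw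
  have hDD : ∀ a ∈ D, ∀ b ∈ D, (G.deleteEdges {s(v, w)}).Adj a b ↔ G.Adj a b := by
    refine fun a ha b hb' => (hadj a b).trans (and_iff_left fun hs => ?_)
    rcases Sym2.eq_iff.1 hs with h1 | h1
    · exact hdisj v hv (h1.1 ▸ ha)
    · exact hdisj v hv (h1.2 ▸ hb')
  let f : C ⊕ D → V := Sum.elim Subtype.val Subtype.val
  have hf : Function.Bijective f := by
    refine ⟨Function.Injective.sumElim Subtype.val_injective Subtype.val_injective ?_, fun x => ?_⟩
    · exact fun a b hab => hdisj _ a.2 (hab ▸ b.2)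
    · rcases reachable_deleteEdges_or hG.connected.preconnected v w x with hx | hx
      · exact ⟨.inl ⟨x, (hC x).2 hx⟩, rfl⟩
      · exact ⟨.inr ⟨x, (hD x).2 hx⟩, rfl⟩
  refine Rooted.Iso.symm ⟨⟨Equiv.ofBijective f hf, ?_⟩, rfl⟩
  rintro (⟨a, ha⟩ | ⟨a, ha⟩) (⟨b, hb'⟩ | ⟨b, hb'⟩)
  · exact ((hCC a ha b hb').symm.trans (C.toSimpleGraph_adj ha hb').symm).trans
      (Rooted.join_adj_inl_inl (.mk C _ ⟨v, hv⟩) (.mk D _ ⟨w, hw⟩) _ _).symm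
  · refine Iff.trans ?_ (Rooted.join_adj_inl_inr (.mk C _ ⟨v, hv⟩) (.mk D _ ⟨w, hw⟩) _ _).symm
    exact (hmix a ha b hb').trans (and_congr Subtype.mk_eq_mk Subtype.mk_eq_mk).symm
  · refine Iff.trans ?_ (Rooted.join_adj_inr_inl (.mk C _ ⟨v, hv⟩) (.mk D _ ⟨w, hw⟩) _ _).symm
    exact (G.adj_comm _ _).trans
      ((hmix b hb' a ha).trans (and_congr Subtype.mk_eq_mk Subtype.mk_eq_mk).symm)
  · exact ((hDD a ha b hb').symm.trans (D.toSimpleGraph_adj ha hb').symm).trans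
      (Rooted.join_adj_inr_inr (.mk C _ ⟨v, hv⟩) (.mk D _ ⟨w, hw⟩) _ _).symm

/-- Every finite tree with a distinguished vertex is described by an expression. -/
theorem exists_iso_tree {V : Type} [Fintype V] {G : SimpleGraph V} (hG : G.IsTree) (v : V) :
    ∃ s : TreeExpr, (Rooted.mk V G v).Iso s.tree := by
  classical
  induction hn : Fintype.card V using Nat.strong_induction_on generalizing V with
  | _ n ih =>
    subst hn
    rcases subsingleton_or_nontrivial V with hV | hV
    · have : Unique V := ⟨⟨v⟩, fun _ => Subsingleton.elim _ _⟩
      refine ⟨.point, ⟨(Equiv.ofUnique V Unit), fun {a b} => ?_⟩, rfl⟩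
      exact ⟨fun h => h.elim, fun h => (h.ne (Subsingleton.elim a b)).elim⟩
    · obtain ⟨w, hw⟩ := hG.connected.preconnected.exists_adj_of_nontrivial v
      have hb : ¬ (G.deleteEdges {s(v, w)}).Reachable v w :=
        SimpleGraph.isBridge_iff.1 (SimpleGraph.isAcyclic_iff_forall_adj_isBridge.1 hG.isAcyclic hw)
      have hac : (G.deleteEdges {s(v, w)}).IsAcyclic := hG.isAcyclic.anti (G.deleteEdges_le _)
      set C := (G.deleteEdges {s(v, w)}).connectedComponentMk v with hC
      set D := (G.deleteEdges {s(v, w)}).connectedComponentMk w with hD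
      have hvD : v ∉ D := fun h => hb (SimpleGraph.ConnectedComponent.exact h)
      have hwC : w ∉ C := fun h => hb (SimpleGraph.ConnectedComponent.exact h).symm
      obtain ⟨s, hs⟩ := ih _ (Fintype.card_subtype_lt hwC) (V := C)
        (hac.isTree_connectedComponent C) ⟨v, rfl⟩ rfl
      obtain ⟨t, ht⟩ := ih _ (Fintype.card_subtype_lt hvD) (V := D)
        (hac.isTree_connectedComponent D) ⟨w, rfl⟩ rfl
      exact ⟨.join s t, (iso_join_connectedComponent hG hw C D rfl rfl).trans (hs.join ht)⟩

namespace Rooted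

/-- `X` is a rooted tree whose root is a leaf, and `a` is the code of the tree attached to it. -/
def IsCodedBy (X : Rooted) (a : ℕ) : Prop :=
  ∃ s : TreeExpr, X.Iso s.tree ∧ s.code = nodeEquiv {a}

theorem Iso.isCodedBy {X Y : Rooted} (h : X.Iso Y) {a : ℕ} : Y.IsCodedBy a → X.IsCodedBy a :=
  fun ⟨s, hs, ha⟩ => ⟨s, h.trans hs, ha⟩

theorem IsCodedBy.iso {X Y : Rooted} {a : ℕ} : X.IsCodedBy a → Y.IsCodedBy a → X.Iso Y :=
  fun ⟨_, hs, ha⟩ ⟨_, ht, hb⟩ =>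
    hs.trans ((TreeExpr.iso_of_code_eq (ha.trans hb.symm)).trans ht.symm)

theorem IsCodedBy.unique {X : Rooted} {a b : ℕ} : X.IsCodedBy a → X.IsCodedBy b → a = b := by
  rintro ⟨s, hs, ha⟩ ⟨t, ht, hb⟩
  have h := TreeExpr.code_eq_of_iso (hs.symm.trans ht)
  rw [ha, hb] at h
  exact Multiset.singleton_inj.1 (nodeEquiv.injective h)

theorem exists_isCodedBy (a : ℕ) : ∃ X : Rooted, X.IsCodedBy a ∧ X.G.IsTree := by
  obtain ⟨s, hs⟩ := TreeExpr.exists_code_eq (nodeEquiv {a})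
  exact ⟨s.tree, ⟨s, Iso.refl _, hs⟩, s.isTree_tree⟩

theorem exists_isCodedBy_of_gdeg_eq_one {X : Rooted} (hX : X.G.IsTree)
    (h : gdeg X.G X.root = 1) : ∃ a, X.IsCodedBy a := by
  obtain ⟨s, φ, hφ⟩ := exists_iso_tree hX X.root
  have h1 : (children s.code).card = 1 := by
    rw [s.card_children_code, ← hφ]
    exact (gdeg_iso φ X.root).trans h
  obtain ⟨a, ha⟩ := Multiset.card_eq_one.1 h1
  exact ⟨a, s, ⟨φ, hφ⟩, by rw [← ha]; exact (nodeEquiv.apply_symm_apply _).symm⟩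

theorem IsCodedBy.map_gdeg {X : Rooted} {a : ℕ} (h : X.IsCodedBy a) :
    Finset.univ.val.map (gdeg X.G) = 1 ::ₘ degs a := by
  classical
  obtain ⟨s, ⟨φ, hφ⟩, ha⟩ := h
  have hs : ∀ {V : Type} [Fintype V] (g : V → ℕ),
      Finset.univ.val.map g = ∑ x, ({g x} : Multiset ℕ) := fun {V} _ g => by
    rw [Finset.sum, ← Multiset.sum_map_singleton (Multiset.map g _), Multiset.map_map]
    rfl
  have h1 := s.sum_gdeg (fun d => ({d} : Multiset ℕ))
  rw [Multiset.sum_map_singleton, ha, children_nodeEquiv, Multiset.map_singleton,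
    Multiset.sum_singleton] at h1
  have h2 : gdeg s.tree.G s.tree.root = 1 := by
    rw [← s.card_children_code, ha, children_nodeEquiv, Multiset.card_singleton]
  rw [hs, ← Multiset.singleton_add, ← h1, ← h2,
    ← TreeExpr.sum_eq_add_sum_ite (fun x => ({gdeg s.tree.G x} : Multiset ℕ)),
    ← Equiv.sum_comp φ.toEquiv]
  exact Finset.sum_congr rfl fun x _ => congrArg _ (gdeg_iso φ x).symm

theorem IsCodedBy.mem_planted_iff {X : Rooted} {a : ℕ} (h : X.IsCodedBy a) {Δ m : ℕ}
    (hΔ : 1 ≤ Δ) : a ∈ planted Δ m ↔ Fintype.card X.V = m + 1 ∧ ∀ x, gdeg X.G x ≤ Δ := by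
  have h1 := congrArg Multiset.card h.map_gdeg
  rw [Multiset.card_map, Multiset.card_cons] at h1
  refine and_congr ?_ ?_
  · rw [show Fintype.card X.V = _ from h1]
    omega
  · have h2 : (∀ d ∈ 1 ::ₘ degs a, d ≤ Δ) ↔ ∀ x, gdeg X.G x ≤ Δ := by
      rw [← h.map_gdeg]
      simp
    rw [← h2, Multiset.forall_mem_cons, and_iff_right hΔ]

end Rooted

/-- A representative of a class of trees, rooted at a given vertex. -/
noncomputable abbrev rootedOut {Δ n : ℕ} (c : TClass Δ n) (r : Fin n) : Rooted :=
  ⟨Fin n, (Quotient.out c).1, r⟩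

section Classes

variable {Δ m : ℕ}

theorem zagreb_eq {c : TClass Δ m} {r : Fin m} {a : ℕ} (h : (rootedOut c r).IsCodedBy a) (α : ℝ) :
    zagreb α (Quotient.out c).1 = 1 + stat (fun d => (d : ℝ) ^ α) a := by
  have h1 := congrArg (fun M => (M.map fun d : ℕ => (d : ℝ) ^ α).sum) h.map_gdeg
  simp only [Multiset.map_map, Multiset.map_cons, Multiset.sum_cons, Nat.cast_one,
    Real.one_rpow] at h1
  exact h1

theorem exists_leaf_isCodedBy (hΔ : 1 ≤ Δ) (hm : 1 ≤ m) (c : TClass Δ (m + 1)) :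
    ∃ a ∈ planted Δ m, ∃ r, (rootedOut c r).IsCodedBy a := by
  classical
  have : Nontrivial (Fin (m + 1)) := Fin.nontrivial_iff_two_le.2 (by omega)
  have hT := (Quotient.out c).2.1
  obtain ⟨r, hr⟩ := hT.exists_vert_degree_one_of_nontrivial
  rw [← SimpleGraph.card_neighborSet_eq_degree, ← Nat.card_eq_fintype_card] at hr
  obtain ⟨a, ha⟩ := Rooted.exists_isCodedBy_of_gdeg_eq_one (X := rootedOut c r) hT hr
  exact ⟨a, (ha.mem_planted_iff hΔ).2 ⟨Fintype.card_fin _, (Quotient.out c).2.2⟩, r, ha⟩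

theorem exists_class_isCodedBy (hΔ : 1 ≤ Δ) {a : ℕ} (ha : a ∈ planted Δ m) :
    ∃ p : TClass Δ (m + 1) × Fin (m + 1), (rootedOut p.1 p.2).IsCodedBy a := by
  obtain ⟨X, hX, hT⟩ := Rooted.exists_isCodedBy a
  obtain ⟨hcard, hdeg⟩ := (hX.mem_planted_iff hΔ).1 ha
  let e : X.V ≃ Fin (m + 1) := Fintype.equivFinOfCardEq hcard
  let φ : X.G ≃g X.G.map e.toEmbedding := SimpleGraph.Iso.map e X.G
  have hd : ∀ v, degr (X.G.map e.toEmbedding) v ≤ Δ := fun v => by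
    obtain ⟨x, rfl⟩ := φ.surjective v
    exact (gdeg_iso φ x).trans_le (hdeg x)
  let T : DTree Δ (m + 1) := ⟨X.G.map e.toEmbedding, φ.isTree_iff.1 hT, hd⟩
  obtain ⟨ψ⟩ : Nonempty ((Quotient.out (⟦T⟧ : TClass Δ (m + 1))).1 ≃g T.1) := Quotient.mk_out T
  refine ⟨(⟦T⟧, ψ.symm (φ X.root)), Rooted.Iso.isCodedBy ⟨ψ.trans φ.symm, ?_⟩ hX⟩
  exact (congrArg φ.symm (ψ.apply_symm_apply _)).trans (φ.symm_apply_apply _)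

theorem class_eq_of_isCodedBy {n : ℕ} {c c' : TClass Δ n} {r r' : Fin n} {a : ℕ}
    (h : (rootedOut c r).IsCodedBy a) (h' : (rootedOut c' r').IsCodedBy a) : c = c' := by
  obtain ⟨φ, -⟩ := h.iso h'
  exact Quotient.out_equiv_out.1 ⟨φ⟩

instance (Δ n : ℕ) : Finite (TClass Δ n) := Quotient.finite _

theorem ncard_planted_le (hΔ : 1 ≤ Δ) :
    (planted Δ m).ncard ≤ Nat.card (TClass Δ (m + 1)) * (m + 1) := by
  choose F hF using fun a : planted Δ m => exists_class_isCodedBy hΔ a.2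
  have hinj : Function.Injective F := fun a b hab =>
    Subtype.ext ((hF a).unique (hab ▸ hF b))
  have := Nat.card_le_card_of_injective F hinj
  rwa [Nat.card_prod, Nat.card_fin, Nat.card_coe_set_eq] at this

theorem card_class_le (hΔ : 3 ≤ Δ) (hm : 1 ≤ m) (α : ℝ) (P : ℝ → Prop) :
    Nat.card {c : TClass Δ (m + 1) // P (zagreb α (Quotient.out c).1)}
      ≤ {a ∈ planted Δ m | P (1 + stat (fun d => (d : ℝ) ^ α) a)}.ncard := by
  have hΔ' : 1 ≤ Δ := by omega
  choose F hF r hr using exists_leaf_isCodedBy (Δ := Δ) hΔ' hm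
  have : Finite {a ∈ planted Δ m | P (1 + stat (fun d => (d : ℝ) ^ α) a)} :=
    (finite_planted hΔ m).subset fun _ h => h.1
  rw [← Nat.card_coe_set_eq]
  refine Nat.card_le_card_of_injective (fun c => ⟨F c.1, hF _, ?_⟩) fun c c' h => ?_
  · rw [← zagreb_eq (hr c.1)]
    exact c.2
  · have h' : F c.1 = F c'.1 := congrArg Subtype.val h
    exact Subtype.ext (class_eq_of_isCodedBy (hr c.1) (h' ▸ hr c'.1))

end Classes

theorem prob_eq_one_sub {Δ n : ℕ} (h : 0 < Nat.card (TClass Δ n)) (P : TClass Δ n → Prop) :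
    prob Δ n P = 1 - prob Δ n fun c => ¬ P c := by
  classical
  have h1 : Nat.card (TClass Δ n) = Nat.card {c // P c} + Nat.card {c // ¬ P c} := by
    rw [← Nat.card_sum]
    exact Nat.card_congr (Equiv.sumCompl P).symm
  have h2 : (Nat.card (TClass Δ n) : ℝ) ≠ 0 := by positivity
  rw [prob, prob, eq_sub_iff_add_eq, ← add_div, div_eq_one_iff_eq h2, h1]
  push_cast
  rfl

end Enumeration

/-- For `3 ≤ Δ` and a real exponent `α`, there is a constant `d_α` such that
for every `ε > 0`, the probability that the general Zagreb index of a uniformly random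
isomorphism class of `Δ`-trees of order `n` differs from `d_α·n` by at most `ε·n` tends to `1`. -/
theorem zagreb_concentration (Δ : ℕ) (hΔ : 3 ≤ Δ) (α : ℝ) :
    ∃ d : ℝ, ∀ ε : ℝ, 0 < ε →
      Tendsto
        (fun n : ℕ => prob Δ n (fun c => |zagreb α (Quotient.out c).1 - d * n| ≤ ε * n))
        atTop (𝓝 1) := by
  obtain ⟨d, hd⟩ := exists_tendsto_tail hΔ fun j => (j : ℝ) ^ α
  refine ⟨d, fun ε hε => ?_⟩
  rw [← tendsto_add_atTop_iff_nat 1]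
  have hlim := (hd (ε / 2) (half_pos hε)).const_sub 1
  rw [sub_zero] at hlim
  have hpos : ∀ m, 1 ≤ m → 0 < (planted Δ m).ncard := fun m hm => by
    obtain ⟨m, rfl⟩ := Nat.exists_eq_add_of_le' hm
    exact one_le_ncard_planted hΔ m
  have hcard : ∀ m, 1 ≤ m → 0 < Nat.card (TClass Δ (m + 1)) := fun m hm =>
    pos_of_mul_pos_left ((hpos m hm).trans_le (ncard_planted_le (by omega))) (Nat.zero_le _)
  refine tendsto_of_tendsto_of_tendsto_of_le_of_le' hlim tendsto_const_nhds ?_ ?_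
  · filter_upwards [eventually_ge_atTop 1, (tendsto_natCast_atTop_atTop (R := ℝ)).eventually_ge_atTop
      (|1 - d| / (ε / 2))] with m hm hm'
    rw [div_le_iff₀ (half_pos hε)] at hm'
    rw [prob_eq_one_sub (hcard m hm)]
    refine sub_le_sub_left ?_ 1
    simp only [not_le]
    set T := {a ∈ planted Δ m | ε / 2 * m < |stat (fun j => (j : ℝ) ^ α) a - d * m|} with hT
    have h1 : Nat.card {c : TClass Δ (m + 1) //
        ε * (m + 1 : ℕ) < |zagreb α (Quotient.out c).1 - d * (m + 1 : ℕ)|} ≤ T.ncard := by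
      refine (card_class_le hΔ hm α fun z => ε * (m + 1 : ℕ) < |z - d * (m + 1 : ℕ)|).trans
        (Set.ncard_le_ncard (fun a ha => ⟨ha.1, ?_⟩) ((finite_planted hΔ m).subset fun _ h => h.1))
      have h := ha.2
      push_cast at h
      have h2 := abs_add_le (stat (fun j => (j : ℝ) ^ α) a - d * m) (1 - d)
      rw [show stat (fun j => (j : ℝ) ^ α) a - d * m + (1 - d)
        = 1 + stat (fun j => (j : ℝ) ^ α) a - d * (m + 1) by ring] at h2
      linarith
    have h2 : ((planted Δ m).ncard : ℝ) ≤ Nat.card (TClass Δ (m + 1)) * (m + 1) := by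
      exact_mod_cast ncard_planted_le (Δ := Δ) (m := m) (by omega)
    have h3 : (0 : ℝ) < (planted Δ m).ncard := by exact_mod_cast hpos m hm
    have h4 : (0 : ℝ) < Nat.card (TClass Δ (m + 1)) := by exact_mod_cast hcard m hm
    rw [prob, div_le_div_iff₀ h4 h3]
    calc _ ≤ (T.ncard : ℝ) * (Nat.card (TClass Δ (m + 1)) * (m + 1)) :=
          mul_le_mul (by exact_mod_cast h1) h2 h3.le (Nat.cast_nonneg _)
      _ = _ := by ring
  · exact Eventually.of_forall fun m => div_le_one_of_le₀
      (by exact_mod_cast Nat.card_le_card_of_injective _ Subtype.val_injective)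
      (Nat.cast_nonneg _)

end TreePaper
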